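/- arXiv:1106.2074 — 6 statements merged into one kernel-verified Lean document; each statement's English description precedes it below -/
import Mathlib

section
/- Let B ∈ M₂(ℤ) be a symmetric matrix with det B < 0 such that −det B is not a perfect square. Then there exists a hyperbolic direct isometry of the lattice (ℤ², B): a matrix g ∈ M₂(ℤ) with det g = 1, gᵀBg = B, and |tr g| > 2 (equivalently, g has a real eigenvalue of absolute value > 1). -/
open Matrix

/-- A solution of Pell's equation `x² - (b² - ac)y² = 1` gives a direct isometry of the binary
form with Gram matrix `!![a, b; b, c]`. -/
lemma transpose_mul_mul_eq_of_pell {R : Type*} [CommRing R] {a b c x y : R}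
    (h : x ^ 2 - (b ^ 2 - a * c) * y ^ 2 = 1) :
    !![x - b * y, -(c * y); a * y, x + b * y]ᵀ * !![a, b; b, c] *
      !![x - b * y, -(c * y); a * y, x + b * y] = !![a, b; b, c] := by
  ext i j
  fin_cases i <;> fin_cases j <;> simp [Matrix.mul_apply, Fin.sum_univ_two]
  · linear_combination a * h
  · linear_combination b * h
  · linear_combination b * h
  · linear_combination c * h

/-- Let `B ∈ M₂(ℤ)` be symmetric with `det B < 0` such that `-det B` is not a
perfect square. Then the lattice `(ℤ², B)` admits a hyperbolic direct isometry: a matrix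
`g ∈ M₂(ℤ)` with `det g = 1`, `gᵀBg = B` and `|tr g| > 2`. -/
theorem exists_hyperbolic_isometry_of_not_isSquare
    (B : Matrix (Fin 2) (Fin 2) ℤ) (hsymm : B.IsSymm) (hdet : B.det < 0)
    (hsq : ¬∃ m : ℤ, -B.det = m ^ 2) :
    ∃ g : Matrix (Fin 2) (Fin 2) ℤ, g.det = 1 ∧ gᵀ * B * g = B ∧ 2 < |g.trace| := by
  obtain ⟨a, b, c, rfl⟩ : ∃ a b c : ℤ, B = !![a, b; b, c] := by
    refine ⟨B 0 0, B 0 1, B 1 1, ?_⟩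
    conv_lhs => rw [Matrix.eta_fin_two B, hsymm.apply 0 1]
  have hd : -(!![a, b; b, c] : Matrix (Fin 2) (Fin 2) ℤ).det = b ^ 2 - a * c := by
    rw [Matrix.det_fin_two_of]; ring
  rw [hd] at hsq
  obtain ⟨s, hx, -⟩ := Pell.Solution₁.exists_pos_of_not_isSquare (d := b ^ 2 - a * c)
    (by linarith) (by rwa [isSquare_iff_exists_sq])
  have h := s.prop
  refine ⟨!![s.x - b * s.y, -(c * s.y); a * s.y, s.x + b * s.y], ?_,
    transpose_mul_mul_eq_of_pell h, ?_⟩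
  · rw [Matrix.det_fin_two_of]
    linear_combination h
  · rw [Matrix.trace_fin_two_of]
    exact lt_abs.mpr (Or.inl (by linarith))
end

section
/- Let B ∈ M₂(ℤ) be a symmetric matrix with det B < 0 such that −det B is not a perfect square. Then the group SO(ℤ², B) = { g ∈ M₂(ℤ) : det g = 1 and gᵀBg = B } of direct isometries of the lattice (ℤ², B) is isomorphic, as an abstract group, to ℤ × ℤ/2ℤ. -/
open Matrix

open scoped MatrixGroups

theorem exp_intCast_mul (n : ℤ) (x : ℝ) : Real.exp (n * x) = Real.exp x ^ n := by
  exact_mod_cast Complex.exp_int_mul x n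

/-- The group of direct isometries of the lattice `(ℤ², B)`. -/
def directIsometries (B : Matrix (Fin 2) (Fin 2) ℤ) : Subgroup SL(2, ℤ) where
  carrier := {g | (g : Matrix (Fin 2) (Fin 2) ℤ)ᵀ * B * g = B}
  one_mem' := by simp
  mul_mem' {g h} hg hh := by
    simp only [Set.mem_ofPred_eq, Matrix.SpecialLinearGroup.coe_mul, transpose_mul] at *
    calc _ = (h : Matrix (Fin 2) (Fin 2) ℤ)ᵀ * ((g : Matrix (Fin 2) (Fin 2) ℤ)ᵀ * B * g) * h := by
          simp only [Matrix.mul_assoc]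
      _ = B := by rw [hg, hh]
  inv_mem' {g} hg := by
    simp only [Set.mem_ofPred_eq] at *
    have hgi : g.1 * (g⁻¹).1 = 1 := by
      rw [← Matrix.SpecialLinearGroup.coe_mul, mul_inv_cancel, Matrix.SpecialLinearGroup.coe_one]
    calc _ = (g⁻¹).1ᵀ * (g.1ᵀ * B * g.1) * (g⁻¹).1 := by rw [hg]
      _ = (g.1 * (g⁻¹).1)ᵀ * B * (g.1 * (g⁻¹).1) := by
          simp only [transpose_mul, Matrix.mul_assoc]
      _ = B := by rw [hgi]; simp

theorem mem_directIsometries {B : Matrix (Fin 2) (Fin 2) ℤ} {g : SL(2, ℤ)} :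
    g ∈ directIsometries B ↔ (g : Matrix (Fin 2) (Fin 2) ℤ)ᵀ * B * g = B := Iff.rfl

theorem neg_mem_directIsometries {B : Matrix (Fin 2) (Fin 2) ℤ} {g : SL(2, ℤ)}
    (hg : g ∈ directIsometries B) : -g ∈ directIsometries B := by
  simpa [mem_directIsometries] using hg

/-- The entries of a direct isometry satisfy the linear relations expressing `B g = g⁻ᵀ B`. -/
theorem entries_of_mem_directIsometries {B : Matrix (Fin 2) (Fin 2) ℤ} (hB : B.IsSymm)
    {g : SL(2, ℤ)} (hg : g ∈ directIsometries B) :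
    B 0 0 * g 0 1 = -(B 1 1 * g 1 0) ∧ B 0 0 * (g 1 1 - g 0 0) = 2 * B 0 1 * g 1 0 := by
  have hb : B 1 0 = B 0 1 := hB.apply 0 1
  have hd : g 0 0 * g 1 1 - g 0 1 * g 1 0 = 1 := by
    rw [← det_fin_two, g.det_coe]
  have h := mem_directIsometries.1 hg
  have h00 := congrFun (congrFun h 0) 0
  have h01 := congrFun (congrFun h 0) 1
  simp only [Matrix.mul_apply, Fin.sum_univ_two, transpose_apply, hb] at h00 h01
  constructor
  · linear_combination g 0 0 * h01 - g 0 1 * h00 - (B 0 1 * g 0 0 + B 1 1 * g 1 0) * hd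
  · linear_combination g 1 0 * h01 - g 1 1 * h00 + (B 0 0 * g 0 0 + B 0 1 * g 1 0) * hd

/-- For an isometry `g` having `(1, w)` as a left eigenvector, this is the eigenvalue. -/
def leftEigenvalue (w : ℝ) (g : Matrix (Fin 2) (Fin 2) ℤ) : ℝ := g 0 0 + g 1 0 * w

section Eigenvalue

variable {B : Matrix (Fin 2) (Fin 2) ℤ} {w : ℝ}

theorem leftEigenvalue_spec (hB : B.IsSymm) (ha : B 0 0 ≠ 0)
    (hw : B 0 0 * w ^ 2 - 2 * B 0 1 * w + B 1 1 = 0) {g : SL(2, ℤ)}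
    (hg : g ∈ directIsometries B) :
    g 0 1 + g 1 1 * w = leftEigenvalue w g * w := by
  obtain ⟨h1, h2⟩ := entries_of_mem_directIsometries hB hg
  have h1' : (B 0 0 : ℝ) * g 0 1 = -(B 1 1 * g 1 0) := by exact_mod_cast h1
  have h2' : (B 0 0 : ℝ) * (g 1 1 - g 0 0) = 2 * B 0 1 * g 1 0 := by exact_mod_cast h2
  have ha' : (B 0 0 : ℝ) ≠ 0 := by exact_mod_cast ha
  apply mul_left_cancel₀ ha'
  unfold leftEigenvalue
  linear_combination h1' + w * h2' - g 1 0 * hw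

theorem leftEigenvalue_mul (hB : B.IsSymm) (ha : B 0 0 ≠ 0)
    (hw : B 0 0 * w ^ 2 - 2 * B 0 1 * w + B 1 1 = 0) {g h : SL(2, ℤ)}
    (hg : g ∈ directIsometries B) :
    leftEigenvalue w (g * h : SL(2, ℤ)) = leftEigenvalue w g * leftEigenvalue w h := by
  have hs := leftEigenvalue_spec hB ha hw hg
  simp only [leftEigenvalue, Matrix.SpecialLinearGroup.coe_mul, Matrix.mul_apply, Fin.sum_univ_two,
    Int.cast_add, Int.cast_mul] at *
  linear_combination (h 1 0 : ℝ) * hs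

theorem leftEigenvalue_mul_conj (hB : B.IsSymm) (ha : B 0 0 ≠ 0)
    (hw : B 0 0 * w ^ 2 - 2 * B 0 1 * w + B 1 1 = 0) {g : SL(2, ℤ)}
    (hg : g ∈ directIsometries B) :
    leftEigenvalue w g * ((g 0 0 + g 1 1 : ℤ) - leftEigenvalue w g) = 1 := by
  have hs := leftEigenvalue_spec hB ha hw hg
  have hd : (g 0 0 : ℝ) * g 1 1 - g 0 1 * g 1 0 = 1 := by
    have := g.det_coe
    rw [det_fin_two] at this
    exact_mod_cast this
  simp only [leftEigenvalue, Int.cast_add] at *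
  linear_combination (g 1 0 : ℝ) * hs + hd

theorem leftEigenvalue_injOn (hB : B.IsSymm) (ha : B 0 0 ≠ 0) (hirr : Irrational w)
    {g h : SL(2, ℤ)} (hg : g ∈ directIsometries B) (hh : h ∈ directIsometries B)
    (heq : leftEigenvalue w g = leftEigenvalue w h) : g = h := by
  obtain ⟨g1, g2⟩ := entries_of_mem_directIsometries hB hg
  obtain ⟨h1, h2⟩ := entries_of_mem_directIsometries hB hh
  unfold leftEigenvalue at heq
  have h10 : g 1 0 = h 1 0 := by
    by_contra hne
    refine (hirr.intCast_mul (sub_ne_zero.2 hne)).ne_int (h 0 0 - g 0 0) ?_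
    push_cast
    linear_combination heq
  have h00 : g 0 0 = h 0 0 := by
    rw [h10] at heq
    exact_mod_cast add_right_cancel heq
  have h01 : g 0 1 = h 0 1 := by
    apply mul_left_cancel₀ ha
    rw [g1, h1, h10]
  have h11 : g 1 1 = h 1 1 := by
    apply mul_left_cancel₀ ha
    rw [h10, h00] at g2
    linear_combination g2 - h2
  ext i j
  fin_cases i <;> fin_cases j <;> assumption

/-- The left eigenvalue as a homomorphism from the group of direct isometries. -/
noncomputable def leftEigenvalueHom (hB : B.IsSymm) (ha : B 0 0 ≠ 0)
    (hw : B 0 0 * w ^ 2 - 2 * B 0 1 * w + B 1 1 = 0) : directIsometries B →* ℝ where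
  toFun g := leftEigenvalue w (g : SL(2, ℤ))
  map_one' := by simp [leftEigenvalue]
  map_mul' g _ := leftEigenvalue_mul hB ha hw g.2

end Eigenvalue

/-- The logarithms of the positive values of a real character form an additive subgroup. -/
def logSubgroup {G : Type*} [Group G] (χ : G →* ℝ) : AddSubgroup ℝ where
  carrier := {x | ∃ g, χ g = Real.exp x}
  zero_mem' := ⟨1, by simp⟩
  add_mem' := by
    rintro x y ⟨g, hg⟩ ⟨h, hh⟩
    exact ⟨g * h, by rw [map_mul, hg, hh, Real.exp_add]⟩
  neg_mem' := by
    rintro x ⟨g, hg⟩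
    exact ⟨g⁻¹, by rw [map_inv, hg, Real.exp_neg]⟩

/-- A Pell solution `x ^ 2 - (-det B) * y ^ 2 = 1` gives a direct isometry. -/
theorem exists_mem_directIsometries_of_pell {B : Matrix (Fin 2) (Fin 2) ℤ} (hB : B.IsSymm)
    {x y : ℤ} (hxy : x ^ 2 - (-B.det) * y ^ 2 = 1) :
    ∃ g ∈ directIsometries B, g 0 0 = x - B 0 1 * y ∧ g 1 0 = B 0 0 * y := by
  have hb : B 1 0 = B 0 1 := hB.apply 0 1
  rw [det_fin_two, hb] at hxy
  refine ⟨⟨!![x - B 0 1 * y, -B 1 1 * y; B 0 0 * y, x + B 0 1 * y], ?_⟩, ?_, rfl, rfl⟩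
  · rw [det_fin_two_of]
    linear_combination hxy
  · apply mem_directIsometries.2
    ext i j
    fin_cases i <;> fin_cases j <;>
      simp [Matrix.mul_apply, Fin.sum_univ_two, hb]
    · linear_combination B 0 0 * hxy
    · linear_combination B 0 1 * hxy
    · linear_combination B 0 1 * hxy
    · linear_combination B 1 1 * hxy

/-- The nontrivial character of `ℤ/2ℤ`, with integer values. -/
def zmodTwoSign (e : ZMod 2) : ℤ := if e = 0 then 1 else -1

theorem zmodTwoSign_add : ∀ d e : ZMod 2, zmodTwoSign (d + e) = zmodTwoSign d * zmodTwoSign e := by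
  decide

theorem exists_irrational_isotropic_slope {B : Matrix (Fin 2) (Fin 2) ℤ} (hB : B.IsSymm)
    (hdet : B.det < 0) (hsq : ¬IsSquare (-B.det)) :
    B 0 0 ≠ 0 ∧ ∃ w : ℝ, Irrational w ∧ B 0 0 * w ^ 2 - 2 * B 0 1 * w + B 1 1 = 0 := by
  have hb : B 1 0 = B 0 1 := hB.apply 0 1
  have hD : B.det = B 0 0 * B 1 1 - B 0 1 * B 0 1 := by rw [det_fin_two, hb]
  have ha : B 0 0 ≠ 0 := by
    intro h
    exact hsq ⟨B 0 1, by rw [hD, h]; ring⟩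
  have hirr : Irrational √((-B.det : ℤ) : ℝ) := irrational_sqrt_intCast_iff.2 ⟨hsq, by lia⟩
  refine ⟨ha, (B 0 1 + √((-B.det : ℤ) : ℝ)) / B 0 0, (hirr.intCast_add _).div_intCast ha, ?_⟩
  have hs : √((-B.det : ℤ) : ℝ) ^ 2 = -(B 0 0 * B 1 1 - B 0 1 * B 0 1) := by
    rw [Real.sq_sqrt (by exact_mod_cast (by lia : 0 ≤ -B.det)), hD]
    push_cast
    ring
  have ha' : (B 0 0 : ℝ) ≠ 0 := by exact_mod_cast ha
  field_simp
  linear_combination hs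

/-- The logarithms of positive left eigenvalues have a nonzero generator. -/
theorem exists_generator_logSubgroup {B : Matrix (Fin 2) (Fin 2) ℤ} {w : ℝ} (hB : B.IsSymm)
    (hdet : B.det < 0) (hsq : ¬IsSquare (-B.det)) (ha : B 0 0 ≠ 0) (hirr : Irrational w)
    (hw : B 0 0 * w ^ 2 - 2 * B 0 1 * w + B 1 1 = 0) :
    ∃ x₀ ≠ 0, ∃ g₀ : directIsometries B, leftEigenvalueHom hB ha hw g₀ = Real.exp x₀ ∧
      ∀ g, 0 < leftEigenvalueHom hB ha hw g →
        ∃ n : ℤ, leftEigenvalueHom hB ha hw g = Real.exp x₀ ^ n := by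
  set χ := leftEigenvalueHom hB ha hw
  obtain ⟨x₀, hx₀⟩ := AddSubgroup.cyclic_of_isolated_zero (H := logSubgroup χ)
    (a := Real.log 2) (Real.log_pos one_lt_two) (by
      rw [Set.disjoint_left]
      rintro x ⟨g, hg⟩ ⟨hx0, hx2⟩
      have h1 : 1 < χ g := by rw [hg]; exact Real.one_lt_exp_iff.2 hx0
      have h2 : χ g < 2 := by rw [hg]; exact (Real.lt_log_iff_exp_lt two_pos).1 hx2
      have hc : χ g * (((g : SL(2, ℤ)) 0 0 + (g : SL(2, ℤ)) 1 1 : ℤ) - χ g) = 1 :=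
        leftEigenvalue_mul_conj hB ha hw g.2
      set t : ℤ := (g : SL(2, ℤ)) 0 0 + (g : SL(2, ℤ)) 1 1
      have ht2 : (2 : ℝ) < t := by nlinarith
      have ht3 : (t : ℝ) < 3 := by nlinarith
      have : 2 < t := by exact_mod_cast ht2
      have : t < 3 := by exact_mod_cast ht3
      lia)
  have hgen : ∀ g, 0 < χ g → ∃ n : ℤ, χ g = Real.exp x₀ ^ n := by
    intro g hg
    have hmem : Real.log (χ g) ∈ logSubgroup χ := ⟨g, (Real.exp_log hg).symm⟩
    rw [hx₀, AddSubgroup.mem_closure_singleton] at hmem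
    obtain ⟨n, hn⟩ := hmem
    exact ⟨n, by rw [← exp_intCast_mul, ← zsmul_eq_mul, hn, Real.exp_log hg]⟩
  have hmem : x₀ ∈ logSubgroup χ := by
    rw [hx₀]
    exact AddSubgroup.mem_closure_singleton_self x₀
  obtain ⟨g₀, hg₀⟩ := hmem
  refine ⟨x₀, ?_, g₀, hg₀, hgen⟩
  rintro rfl
  obtain ⟨x, y, hxy, hy⟩ := Pell.exists_of_not_isSquare (by lia) hsq
  obtain ⟨g, hg, -, h10⟩ := exists_mem_directIsometries_of_pell hB hxy
  have h10' : g 1 0 ≠ 0 := by rw [h10]; exact mul_ne_zero ha hy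
  have hne : ∀ z : ℤ, χ ⟨g, hg⟩ ≠ z := fun z =>
    ((hirr.intCast_mul h10').intCast_add (g 0 0)).ne_int z
  rcases lt_trichotomy (χ ⟨g, hg⟩) 0 with h | h | h
  · obtain ⟨n, hn⟩ := hgen (⟨g, hg⟩ ^ 2) (by rw [map_pow]; exact sq_pos_of_neg h)
    rw [map_pow, Real.exp_zero, _root_.one_zpow, sq_eq_one_iff] at hn
    exact hn.elim (fun h1 => hne 1 (by simpa using h1)) fun h1 => hne (-1) (by simpa using h1)
  · exact hne 0 (by simpa using h)
  · obtain ⟨n, hn⟩ := hgen _ h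
    exact hne 1 (by simpa using hn)

/-- Let `B ∈ M₂(ℤ)` be symmetric with `det B < 0` such that `-det B` is not a
perfect square. Then the group `SO(ℤ², B) = {g ∈ M₂(ℤ) : det g = 1, gᵀBg = B}` of direct
isometries of the lattice `(ℤ², B)` is isomorphic, as an abstract group, to `ℤ × ℤ/2ℤ`.
We express this by a map `f : ℤ × ℤ/2ℤ → M₂(ℤ)` which is injective, multiplicative
(sending addition to matrix multiplication, hence `f 0 = 1` and `f` preserves inverses),
and whose range is exactly `SO(ℤ², B)`. -/
theorem so_isomorphic_int_prod_zmod_two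
    (B : Matrix (Fin 2) (Fin 2) ℤ) (hsymm : B.IsSymm) (hdet : B.det < 0)
    (hsq : ¬∃ m : ℤ, -B.det = m ^ 2) :
    ∃ f : ℤ × ZMod 2 → Matrix (Fin 2) (Fin 2) ℤ,
      Function.Injective f ∧
      (∀ p q : ℤ × ZMod 2, f (p + q) = f p * f q) ∧
      Set.range f = {g : Matrix (Fin 2) (Fin 2) ℤ | g.det = 1 ∧ gᵀ * B * g = B} := by
  rw [← isSquare_iff_exists_sq] at hsq
  obtain ⟨ha, w, hirr, hw⟩ := exists_irrational_isotropic_slope hsymm hdet hsq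
  obtain ⟨x₀, hx₀, g₀, hg₀, hgen⟩ :=
    exists_generator_logSubgroup hsymm hdet hsq ha hirr hw
  have hpow : ∀ n : ℤ, leftEigenvalue w (g₀ ^ n : directIsometries B).1 = Real.exp (n * x₀) := by
    intro n
    rw [exp_intCast_mul, ← hg₀, ← map_zpow]
    rfl
  have hsmul : ∀ (n : ℤ) (A : Matrix (Fin 2) (Fin 2) ℤ),
      leftEigenvalue w (n • A) = n * leftEigenvalue w A := by
    intro n A
    simp [leftEigenvalue]
    ring
  refine ⟨fun p => zmodTwoSign p.2 • ((g₀ ^ p.1 : directIsometries B) : SL(2, ℤ)).1,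
    ?_, ?_, ?_⟩
  · rintro ⟨m, d⟩ ⟨n, e⟩ heq
    have h := congrArg (leftEigenvalue w) heq
    simp only [hsmul, hpow] at h
    have hm := Real.exp_pos (m * x₀)
    have hn := Real.exp_pos (n * x₀)
    have hde : d = e := by
      by_contra hne
      obtain ⟨hd, he⟩ | ⟨hd, he⟩ : (d = 0 ∧ e = 1) ∨ (d = 1 ∧ e = 0) := by
        clear * - hne
        decide +revert
      all_goals
        rw [hd, he] at h
        norm_num [zmodTwoSign] at h
        linarith
    subst hde
    have hs : (zmodTwoSign d : ℝ) ≠ 0 := by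
      unfold zmodTwoSign
      split_ifs <;> simp
    have := mul_right_cancel₀ hx₀ (Real.exp_injective (mul_left_cancel₀ hs h))
    rw [Int.cast_injective this]
  · rintro ⟨m, d⟩ ⟨n, e⟩
    simp only [Prod.mk_add_mk, zmodTwoSign_add, _root_.zpow_add, Subgroup.coe_mul,
      Matrix.SpecialLinearGroup.coe_mul, smul_mul_smul_comm]
  · ext g
    simp only [Set.mem_range, Prod.exists, Set.mem_ofPred_eq]
    constructor
    · rintro ⟨n, e, rfl⟩
      have hmem := mem_directIsometries.1 (g₀ ^ n).2
      have hd := ((g₀ ^ n : directIsometries B) : SL(2, ℤ)).det_coe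
      unfold zmodTwoSign
      split_ifs
      · rw [one_smul]
        exact ⟨hd, hmem⟩
      · rw [neg_one_smul]
        exact ⟨by simp [det_neg], by simpa using hmem⟩
    · rintro ⟨hd, hg⟩
      have key : ∀ h : directIsometries B, 0 < leftEigenvalueHom hsymm ha hw h →
          ∃ n : ℤ, h = g₀ ^ n := by
        intro h hpos
        obtain ⟨n, hn⟩ := hgen h hpos
        refine ⟨n, Subtype.ext (leftEigenvalue_injOn hsymm ha hirr h.2 (g₀ ^ n).2 ?_)⟩
        rw [hpow, exp_intCast_mul]
        exact hn
      have hmem : (⟨g, hd⟩ : SL(2, ℤ)) ∈ directIsometries B := mem_directIsometries.2 hg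
      let h : directIsometries B := ⟨_, hmem⟩
      let h' : directIsometries B := ⟨_, neg_mem_directIsometries hmem⟩
      have hcoe : h'.1.1 = -g := Matrix.SpecialLinearGroup.coe_neg _
      have hneg : leftEigenvalueHom hsymm ha hw h' = -leftEigenvalueHom hsymm ha hw h := by
        change leftEigenvalue w h'.1.1 = -leftEigenvalue w g
        rw [hcoe, ← neg_one_smul ℤ, hsmul]
        simp
      have hne : leftEigenvalueHom hsymm ha hw h ≠ 0 :=
        left_ne_zero_of_mul_eq_one (leftEigenvalue_mul_conj hsymm ha hw h.2)
      rcases hne.lt_or_gt with hlt | hgt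
      · obtain ⟨n, hn⟩ := key h' (by rw [hneg]; linarith)
        refine ⟨n, 1, ?_⟩
        rw [← hn]
        simp [zmodTwoSign, hcoe]
      · obtain ⟨n, hn⟩ := key h hgt
        refine ⟨n, 0, ?_⟩
        rw [← hn]
        simp [zmodTwoSign, h]
end

section
/- Let B ∈ M₂(ℤ) be a symmetric matrix with det B < 0 such that −det B is a perfect square. Then the only direct isometries of the lattice (ℤ², B) are ± the identity: if g ∈ M₂(ℤ) satisfies det g = 1 and gᵀBg = B, then g = I₂ or g = −I₂. In particular the lattice admits no hyperbolic isometry of determinant 1. -/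
open Matrix

/-- Every integer point of the hyperbola `t² - 4 = k²` has `k = 0`. -/
lemma Int.eq_zero_of_sq_sub_four_eq_sq {t k : ℤ} (h : t ^ 2 - 4 = k ^ 2) : k = 0 := by
  rw [← sq_abs t, ← sq_abs k] at h
  rw [← abs_eq_zero]
  have ht := abs_nonneg t
  have hk := abs_nonneg k
  generalize |t| = t at *
  generalize |k| = k at *
  have hlt : k < t := by nlinarith
  rcases eq_or_lt_of_le (Int.add_one_le_iff.mpr hlt) with rfl | hlt'
  · ring_nf at h
    omega
  · nlinarith

/-- The direct isometries of a rank-2 lattice whose discriminant is a nonzero square are `±1`. -/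
lemma eq_one_or_eq_neg_one_of_direct_isometry {B g : Matrix (Fin 2) (Fin 2) ℤ} {m : ℤ}
    (hsymm : B.IsSymm) (hm : m ≠ 0) (hsq : -B.det = m ^ 2)
    (hg : g.det = 1) (hiso : gᵀ * B * g = B) : g = 1 ∨ g = -1 := by
  have hcomm : gᵀ * B = B * g.adjugate := by
    calc gᵀ * B = gᵀ * B * (g * g.adjugate) := by rw [mul_adjugate, hg, one_smul, mul_one]
      _ = B * g.adjugate := by rw [← mul_assoc, hiso]
  have h10 : B 1 0 = B 0 1 := hsymm.apply 0 1
  have h₀₀ := congrFun₂ hcomm 0 0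
  have h₀₁ := congrFun₂ hcomm 0 1
  have h₁₀ := congrFun₂ hcomm 1 0
  have h₁₁ := congrFun₂ hcomm 1 1
  simp only [adjugate_fin_two, mul_apply, Fin.sum_univ_two, transpose_apply, of_apply,
    cons_val_zero, cons_val_one, cons_val', cons_val_fin_one, h10] at h₀₀ h₀₁ h₁₀ h₁₁
  rw [det_fin_two, h10] at hsq
  rw [det_fin_two] at hg
  suffices h : g 1 0 = 0 ∧ g 0 1 = 0 ∧ g 1 1 = g 0 0 by
    obtain ⟨hr, hq, hs⟩ := h
    rw [hr, hs, mul_zero, sub_zero] at hg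
    rcases mul_self_eq_one_iff.mp hg with hp | hp
    · left
      ext i j
      fin_cases i <;> fin_cases j <;> simp [hr, hq, hs, hp]
    · right
      ext i j
      fin_cases i <;> fin_cases j <;> simp [hr, hq, hs, hp]
  generalize B 0 0 = a, B 0 1 = b, B 1 1 = c, g 0 0 = p, g 0 1 = q, g 1 0 = r, g 1 1 = s at *
  have hps : a * (s - p) = 2 * b * r := by linarith
  have hqr : a * q = -(c * r) := by linarith
  have hqb : 2 * b * q = c * (p - s) := by linarith
  by_cases ha : a = 0
  · subst ha
    have hb : b ≠ 0 := by
      rintro rfl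
      exact hm (by simpa using hsq.symm)
    have hr : r = 0 := by simpa [hb] using hps.symm
    subst hr
    have hs : p = s := by
      rcases Int.mul_eq_one_iff_eq_one_or_neg_one.mp (by linarith : p * s = 1) with h | h <;> omega
    subst hs
    exact ⟨rfl, by simpa [hb] using hqb, rfl⟩
  · have hkey : a ^ 2 * ((p + s) ^ 2 - 4) = (2 * r * m) ^ 2 := by
      linear_combination (a * (s - p) + 2 * b * r) * hps + 4 * a * r * hqr
        + 4 * r ^ 2 * hsq + 4 * a ^ 2 * hg
    obtain ⟨k, hk⟩ : a ∣ 2 * r * m :=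
      (Int.pow_dvd_pow_iff two_ne_zero).mp ⟨_, hkey.symm⟩
    have hk0 : k = 0 := by
      refine Int.eq_zero_of_sq_sub_four_eq_sq (t := p + s) ?_
      refine mul_left_cancel₀ (pow_ne_zero 2 ha) ?_
      rw [hkey, hk, mul_pow]
    have hr : r = 0 := by simpa [hk0, hm] using hk
    subst hr
    refine ⟨rfl, by simpa [ha] using hqr, ?_⟩
    have : s - p = 0 := by simpa [ha] using hps
    omega

/-- Let `B ∈ M₂(ℤ)` be symmetric with `det B < 0` such that `-det B` is a
perfect square. Then the only direct isometries of the lattice `(ℤ², B)` are `±I₂`; in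
particular there is no hyperbolic isometry of determinant `1`. -/
theorem direct_isometries_eq_pm_id_of_isSquare
    (B : Matrix (Fin 2) (Fin 2) ℤ) (hsymm : B.IsSymm) (hdet : B.det < 0)
    (hsq : ∃ m : ℤ, -B.det = m ^ 2) :
    (∀ g : Matrix (Fin 2) (Fin 2) ℤ, g.det = 1 → gᵀ * B * g = B → g = 1 ∨ g = -1) ∧
    ¬∃ g : Matrix (Fin 2) (Fin 2) ℤ, g.det = 1 ∧ gᵀ * B * g = B ∧ 2 < |g.trace| := by
  obtain ⟨m, hm⟩ := hsq
  have hm0 : m ≠ 0 := by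
    rintro rfl
    simp [hdet.ne] at hm
  refine ⟨fun g => eq_one_or_eq_neg_one_of_direct_isometry hsymm hm0 hm, ?_⟩
  rintro ⟨g, hg, hiso, htr⟩
  rcases eq_one_or_eq_neg_one_of_direct_isometry hsymm hm0 hm hg hiso with rfl | rfl <;>
    simp at htr
end

section
/- Let B ∈ M₂(ℤ) be a symmetric matrix with det B < 0, and let g ∈ M₂(ℤ) be a hyperbolic direct isometry of (ℤ², B), i.e. det g = 1, gᵀBg = B and |tr g| > 2. Then the cyclic subgroup generated by g has finite index in the full isometry group O(ℤ², B) = { h ∈ M₂(ℤ) : hᵀBh = B }. -/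
open Matrix

/-- The group of direct isometries of the lattice `(ℤ², B)`. -/
def directIsometryGroup (B : Matrix (Fin 2) (Fin 2) ℤ) :
    Subgroup (Matrix.SpecialLinearGroup (Fin 2) ℤ) where
  carrier := {h | (h : Matrix (Fin 2) (Fin 2) ℤ)ᵀ * B * (h : Matrix (Fin 2) (Fin 2) ℤ) = B}
  one_mem' := by simp
  mul_mem' {x y} hx hy := by
    rw [Set.mem_ofPred_eq] at hx hy ⊢
    rw [Matrix.SpecialLinearGroup.coe_mul, transpose_mul]
    calc _ = (y : Matrix (Fin 2) (Fin 2) ℤ)ᵀ * ((x : Matrix (Fin 2) (Fin 2) ℤ)ᵀ * B * x) * y := by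
          simp only [Matrix.mul_assoc]
      _ = B := by rw [hx, hy]
  inv_mem' {x} hx := by
    rw [Set.mem_ofPred_eq] at hx ⊢
    have hinv : (x : Matrix (Fin 2) (Fin 2) ℤ) * (x⁻¹).1 = 1 := by
      rw [← Matrix.SpecialLinearGroup.coe_mul, mul_inv_cancel, Matrix.SpecialLinearGroup.coe_one]
    generalize (x⁻¹).1 = y at hinv ⊢
    calc yᵀ * B * y = yᵀ * ((x : Matrix (Fin 2) (Fin 2) ℤ)ᵀ * B * x) * y := by rw [hx]
      _ = ((x : Matrix (Fin 2) (Fin 2) ℤ) * y)ᵀ * B * (x * y) := by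
          simp only [transpose_mul, Matrix.mul_assoc]
      _ = B := by rw [hinv, transpose_one, Matrix.one_mul, Matrix.mul_one]

lemma mem_directIsometryGroup {B : Matrix (Fin 2) (Fin 2) ℤ}
    {h : Matrix.SpecialLinearGroup (Fin 2) ℤ} :
    h ∈ directIsometryGroup B ↔
      (h : Matrix (Fin 2) (Fin 2) ℤ)ᵀ * B * (h : Matrix (Fin 2) (Fin 2) ℤ) = B :=
  Iff.rfl

/-- The vector `(h₁₀, h₁₁ - h₀₀, -h₀₁)` attached to a direct isometry `h` is proportional to the
coefficient vector `(B₀₀, 2B₀₁, B₁₁)` of the quadratic form. -/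
lemma directIsometryGroup_proportional {B : Matrix (Fin 2) (Fin 2) ℤ} (hsymm : B.IsSymm)
    {h : Matrix.SpecialLinearGroup (Fin 2) ℤ} (hh : h ∈ directIsometryGroup B) :
    B 0 0 * h 0 1 = -(B 1 1 * h 1 0) ∧ B 0 0 * (h 1 1 - h 0 0) = 2 * B 0 1 * h 1 0 ∧
      B 1 1 * (h 0 0 - h 1 1) = 2 * B 0 1 * h 0 1 := by
  have hd := h.det_coe
  rw [det_fin_two] at hd
  have hB : B 1 0 = B 0 1 := hsymm.apply 0 1
  rw [mem_directIsometryGroup] at hh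
  have key := fun i j => congrFun (congrFun hh i) j
  have h00 := key 0 0
  have h01 := key 0 1
  have h11 := key 1 1
  simp only [mul_apply, Fin.sum_univ_two, transpose_apply, hB] at h00 h01 h11
  generalize h 0 0 = p at *
  generalize h 0 1 = q at *
  generalize h 1 0 = r at *
  generalize h 1 1 = s at *
  generalize B 0 0 = a at *
  generalize B 0 1 = b at *
  generalize B 1 1 = c at *
  refine ⟨?_, ?_, ?_⟩ <;> grind

/-- Entries of a direct isometry in terms of its trace. -/
lemma directIsometryGroup_sq {B : Matrix (Fin 2) (Fin 2) ℤ} (hsymm : B.IsSymm)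
    {h : Matrix.SpecialLinearGroup (Fin 2) ℤ} (hh : h ∈ directIsometryGroup B) :
    -B.det * (4 * h 1 0 ^ 2) = B 0 0 ^ 2 * ((h 0 0 + h 1 1) ^ 2 - 4) ∧
    -B.det * (4 * h 0 1 ^ 2) = B 1 1 ^ 2 * ((h 0 0 + h 1 1) ^ 2 - 4) ∧
    -B.det * (h 1 1 - h 0 0) ^ 2 = B 0 1 ^ 2 * ((h 0 0 + h 1 1) ^ 2 - 4) := by
  obtain ⟨h1, h2, h3⟩ := directIsometryGroup_proportional hsymm hh
  have hd := h.det_coe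
  rw [det_fin_two] at hd
  have hB : B 1 0 = B 0 1 := hsymm.apply 0 1
  rw [det_fin_two, hB]
  generalize h 0 0 = p at *
  generalize h 0 1 = q at *
  generalize h 1 0 = r at *
  generalize h 1 1 = s at *
  generalize B 0 0 = a at *
  generalize B 0 1 = b at *
  generalize B 1 1 = c at *
  refine ⟨?_, ?_, ?_⟩ <;> grind

lemma trace_mul_trace_inv_mul {B : Matrix (Fin 2) (Fin 2) ℤ} (hsymm : B.IsSymm) (hdet : B.det ≠ 0)
    {g h : Matrix.SpecialLinearGroup (Fin 2) ℤ} (hg : g ∈ directIsometryGroup B)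
    (hh : h ∈ directIsometryGroup B) :
    (g * h).1.trace * (g⁻¹ * h).1.trace = h.1.trace ^ 2 + g.1.trace ^ 2 - 4 := by
  obtain ⟨h1, h2, h3⟩ := directIsometryGroup_proportional hsymm hh
  obtain ⟨g1, g2, g3⟩ := directIsometryGroup_proportional hsymm hg
  have hd := h.det_coe
  have gd := g.det_coe
  have hB : B 1 0 = B 0 1 := hsymm.apply 0 1
  rw [det_fin_two] at hd gd hdet
  rw [hB] at hdet
  simp only [Matrix.SpecialLinearGroup.coe_mul, Matrix.SpecialLinearGroup.coe_inv,
    adjugate_fin_two, trace_fin_two, mul_apply, Fin.sum_univ_two, of_apply, cons_val',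
    cons_val_zero, cons_val_one, cons_val_fin_one]
  generalize h.1 0 0 = p at *
  generalize h.1 0 1 = q at *
  generalize h.1 1 0 = r at *
  generalize h.1 1 1 = s at *
  generalize g.1 0 0 = p' at *
  generalize g.1 0 1 = q' at *
  generalize g.1 1 0 = r' at *
  generalize g.1 1 1 = s' at *
  generalize B 0 0 = a at *
  generalize B 0 1 = b at *
  generalize B 1 1 = c at *
  have e1 : q * r' - q' * r = 0 := by
    refine (mul_eq_zero_iff_left hdet).mp ?_
    grind
  have e2 : (s - p) * r' - (s' - p') * r = 0 := by
    refine (mul_eq_zero_iff_left hdet).mp ?_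
    grind
  have e3 : (s - p) * q' - (s' - p') * q = 0 := by
    refine (mul_eq_zero_iff_left hdet).mp ?_
    grind
  grind

lemma trace_mul_add_trace_inv_mul (g h : Matrix.SpecialLinearGroup (Fin 2) ℤ) :
    (g * h).1.trace + (g⁻¹ * h).1.trace = g.1.trace * h.1.trace := by
  simp only [Matrix.SpecialLinearGroup.coe_mul, Matrix.SpecialLinearGroup.coe_inv,
    adjugate_fin_two, trace_fin_two, mul_apply, Fin.sum_univ_two, of_apply, cons_val',
    cons_val_zero, cons_val_one, cons_val_fin_one]
  ring

/-- If `|x|` is minimal among consecutive terms `y, x, z` of a sequence with the trace recurrence,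
then it is bounded in terms of `t`. -/
lemma sq_le_of_trace_recurrence {t x y z : ℤ} (ht : 2 < |t|) (hadd : y + z = t * x)
    (hmul : y * z = x ^ 2 + t ^ 2 - 4) (hy : |x| ≤ |y|) (hz : |x| ≤ |z|) : x ^ 2 ≤ t ^ 2 := by
  have ht2 : 4 < |t| ^ 2 := by nlinarith
  have hpos : 0 < y * z := by
    rw [hmul, ← sq_abs t]; nlinarith [sq_nonneg x]
  have habs : |y| + |z| = |t| * |x| := by
    rw [← abs_mul, ← hadd]
    rcases mul_pos_iff.mp hpos with ⟨h1, h2⟩ | ⟨h1, h2⟩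
    · rw [abs_of_pos h1, abs_of_pos h2, abs_of_pos (add_pos h1 h2)]
    · rw [abs_of_neg h1, abs_of_neg h2, abs_of_neg (add_neg h1 h2)]; ring
  have hmul' : |y| * |z| = |x| ^ 2 + |t| ^ 2 - 4 := by
    rw [← abs_mul, abs_of_pos hpos, hmul, sq_abs, sq_abs]
  rw [← sq_abs x, ← sq_abs t]
  have hprod := mul_nonneg (sub_nonneg.mpr hy) (sub_nonneg.mpr hz)
  have hle : (|t| - 2) * |x| ^ 2 ≤ |t| ^ 2 - 4 := by
    linear_combination hprod + hmul' - |x| * habs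
  nlinarith [sq_nonneg |x|]

lemma exists_zpow_mul_trace_sq_le {B : Matrix (Fin 2) (Fin 2) ℤ} (hsymm : B.IsSymm)
    (hdet : B.det ≠ 0) {g h : Matrix.SpecialLinearGroup (Fin 2) ℤ}
    (hg : g ∈ directIsometryGroup B) (htr : 2 < |g.1.trace|) (hh : h ∈ directIsometryGroup B) :
    ∃ n : ℤ, (g ^ n * h).1.trace ^ 2 ≤ g.1.trace ^ 2 := by
  let f : ℤ → ℕ := fun n => (g ^ n * h).1.trace.natAbs
  let n := Function.argmin f
  have hmin : ∀ m : ℤ, |(g ^ n * h).1.trace| ≤ |(g ^ m * h).1.trace| := fun m => by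
    rw [Int.abs_eq_natAbs, Int.abs_eq_natAbs]
    exact Int.ofNat_le.mpr (Function.argmin_le f m)
  have hk : g ^ n * h ∈ directIsometryGroup B := mul_mem (zpow_mem hg n) hh
  refine ⟨n, sq_le_of_trace_recurrence htr (trace_mul_add_trace_inv_mul g (g ^ n * h))
    (trace_mul_trace_inv_mul hsymm hdet hg hk) ?_ ?_⟩
  · rw [← mul_assoc, ← _root_.zpow_one_add]
    exact hmin _
  · rw [← mul_assoc, ← _root_.zpow_neg_one, ← _root_.zpow_add]
    exact hmin _

lemma directIsometryGroup_entry_bound {B : Matrix (Fin 2) (Fin 2) ℤ} (hsymm : B.IsSymm)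
    (hdet : B.det < 0) {h : Matrix.SpecialLinearGroup (Fin 2) ℤ} (hh : h ∈ directIsometryGroup B)
    {T : ℤ} (hT : h.1.trace ^ 2 ≤ T) (i j : Fin 2) :
    h i j ^ 2 ≤ (B 0 0 ^ 2 + B 0 1 ^ 2 + B 1 1 ^ 2 + 1) * T := by
  obtain ⟨h1, h2, h3⟩ := directIsometryGroup_sq hsymm hh
  rw [trace_fin_two] at hT
  have hT0 : 0 ≤ T := (sq_nonneg _).trans hT
  have aux : ∀ {x c : ℤ}, -B.det * x ^ 2 = c ^ 2 * ((h 0 0 + h 1 1) ^ 2 - 4) →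
      x ^ 2 ≤ c ^ 2 * T := fun {x c} e => by
    have : c ^ 2 * ((h 0 0 + h 1 1) ^ 2 - 4) ≤ c ^ 2 * T :=
      mul_le_mul_of_nonneg_left (by linarith) (sq_nonneg c)
    nlinarith [sq_nonneg x]
  have b1 := aux (x := 2 * h 1 0) (by rw [← h1]; ring)
  have b2 := aux (x := 2 * h 0 1) (by rw [← h2]; ring)
  have b3 := aux h3
  have n1 := mul_nonneg (sq_nonneg (B 0 0)) hT0
  have n2 := mul_nonneg (sq_nonneg (B 0 1)) hT0
  have n3 := mul_nonneg (sq_nonneg (B 1 1)) hT0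
  fin_cases i <;> fin_cases j <;> dsimp only [Fin.zero_eta, Fin.mk_one]
  · nlinarith [sq_nonneg (h 0 0), sq_nonneg (h 1 1)]
  · nlinarith [sq_nonneg (h 0 1)]
  · nlinarith [sq_nonneg (h 1 0)]
  · nlinarith [sq_nonneg (h 0 0), sq_nonneg (h 1 1)]

lemma exists_finset_directIsometryGroup {B : Matrix (Fin 2) (Fin 2) ℤ} (hsymm : B.IsSymm)
    (hdet : B.det < 0) {g : Matrix.SpecialLinearGroup (Fin 2) ℤ}
    (hg : g ∈ directIsometryGroup B) (htr : 2 < |g.1.trace|) :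
    ∃ S : Finset (Matrix (Fin 2) (Fin 2) ℤ), (∀ s ∈ S, sᵀ * B * s = B) ∧
      ∀ h ∈ directIsometryGroup B, ∃ n : ℤ, ∃ s ∈ S, h.1 = (g ^ n).1 * s := by
  let M : ℤ := (B 0 0 ^ 2 + B 0 1 ^ 2 + B 1 1 ^ 2 + 1) * g.1.trace ^ 2
  let box : Finset (Matrix (Fin 2) (Fin 2) ℤ) :=
    Fintype.piFinset fun _ => Fintype.piFinset fun _ => Finset.Icc (-M) M
  refine ⟨box.filter fun s => sᵀ * B * s = B, fun s hs => (Finset.mem_filter.mp hs).2,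
    fun h hh => ?_⟩
  obtain ⟨n, hn⟩ := exists_zpow_mul_trace_sq_le hsymm hdet.ne hg htr hh
  have hk : g ^ n * h ∈ directIsometryGroup B := mul_mem (zpow_mem hg n) hh
  refine ⟨-n, (g ^ n * h).1, Finset.mem_filter.mpr ⟨?_, hk⟩, ?_⟩
  · refine Fintype.mem_piFinset.mpr fun i => Fintype.mem_piFinset.mpr fun j => ?_
    have hb : (g ^ n * h).1 i j ^ 2 ≤ M := directIsometryGroup_entry_bound hsymm hdet hk hn i j
    rw [Finset.mem_Icc, ← abs_le]
    exact (Int.le_self_sq _).trans ((sq_abs _).trans_le hb)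
  · rw [← Matrix.SpecialLinearGroup.coe_mul, _root_.zpow_neg, inv_mul_cancel_left]

lemma det_eq_one_or_neg_one_of_isometry {B h : Matrix (Fin 2) (Fin 2) ℤ} (hdet : B.det ≠ 0)
    (hh : hᵀ * B * h = B) : h.det = 1 ∨ h.det = -1 := by
  rw [← sq_eq_one_iff]
  have := congrArg det hh
  rw [det_mul, det_mul, det_transpose] at this
  exact mul_right_cancel₀ hdet (by linear_combination this)

/-- Let `B ∈ M₂(ℤ)` be symmetric with `det B < 0`, and let `g` be a hyperbolic
direct isometry of `(ℤ², B)` (an element of `SL₂(ℤ)`, so `det g = 1`, with `gᵀBg = B` and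
`|tr g| > 2`). Then the cyclic subgroup generated by `g` has finite index in the full isometry
group `O(ℤ², B) = {h ∈ M₂(ℤ) : hᵀBh = B}`: there is a finite set `S` of isometries such that
every isometry `h` lies in some coset `gⁿ • S`, `n ∈ ℤ`. -/
theorem cyclic_finite_index_in_isometry_group
    (B : Matrix (Fin 2) (Fin 2) ℤ) (hsymm : B.IsSymm) (hdet : B.det < 0)
    (g : Matrix.SpecialLinearGroup (Fin 2) ℤ)
    (hiso : (g : Matrix (Fin 2) (Fin 2) ℤ)ᵀ * B * (g : Matrix (Fin 2) (Fin 2) ℤ) = B)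
    (htr : 2 < |(g : Matrix (Fin 2) (Fin 2) ℤ).trace|) :
    ∃ S : Finset (Matrix (Fin 2) (Fin 2) ℤ),
      (∀ s ∈ S, sᵀ * B * s = B) ∧
      ∀ h : Matrix (Fin 2) (Fin 2) ℤ, hᵀ * B * h = B →
        ∃ n : ℤ, ∃ s ∈ S, h = ((g ^ n : Matrix.SpecialLinearGroup (Fin 2) ℤ) :
          Matrix (Fin 2) (Fin 2) ℤ) * s := by
  obtain ⟨S, hS, hcov⟩ := exists_finset_directIsometryGroup hsymm hdet hiso htr
  by_cases hex : ∃ k : Matrix (Fin 2) (Fin 2) ℤ, kᵀ * B * k = B ∧ k.det = -1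
  · obtain ⟨k, hk, hkdet⟩ := hex
    have hunit : IsUnit k.det := by rw [hkdet]; exact isUnit_one.neg
    have hkinv : k⁻¹ᵀ * B * k⁻¹ = B := by
      calc k⁻¹ᵀ * B * k⁻¹ = k⁻¹ᵀ * (kᵀ * B * k) * k⁻¹ := by rw [hk]
        _ = (k * k⁻¹)ᵀ * B * (k * k⁻¹) := by simp only [transpose_mul, Matrix.mul_assoc]
        _ = B := by rw [mul_nonsing_inv k hunit]; simp
    have hmul : ∀ {x y : Matrix (Fin 2) (Fin 2) ℤ}, xᵀ * B * x = B → yᵀ * B * y = B →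
        (x * y)ᵀ * B * (x * y) = B := fun {x y} hx hy => by
      calc _ = yᵀ * (xᵀ * B * x) * y := by simp only [transpose_mul, Matrix.mul_assoc]
        _ = B := by rw [hx, hy]
    classical
    refine ⟨S ∪ S.image (· * k), fun s hs => ?_, fun h hh => ?_⟩
    · rcases Finset.mem_union.mp hs with hs | hs
      · exact hS s hs
      · obtain ⟨s, hsS, rfl⟩ := Finset.mem_image.mp hs
        exact hmul (hS s hsS) hk
    · rcases det_eq_one_or_neg_one_of_isometry hdet.ne hh with hd | hd
      · obtain ⟨n, s, hs, e⟩ := hcov ⟨h, hd⟩ hh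
        exact ⟨n, s, Finset.mem_union_left _ hs, e⟩
      · have hd' : (h * k⁻¹).det = 1 := by
          have := congrArg det (nonsing_inv_mul_cancel_right k h hunit)
          rw [det_mul, hkdet, hd] at this
          linarith
        obtain ⟨n, s, hs, e⟩ := hcov ⟨h * k⁻¹, hd'⟩ (hmul hh hkinv)
        refine ⟨n, s * k, Finset.mem_union_right _ (Finset.mem_image_of_mem _ hs), ?_⟩
        rw [← Matrix.mul_assoc, ← e, nonsing_inv_mul_cancel_right k h hunit]
  · refine ⟨S, hS, fun h hh => ?_⟩
    rcases det_eq_one_or_neg_one_of_isometry hdet.ne hh with hd | hd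
    · exact hcov ⟨h, hd⟩ hh
    · exact absurd ⟨h, hh, hd⟩ hex
end

section
/- Let B ∈ M₂(ℤ) be a symmetric matrix with det B < 0, and let g ∈ M₂(ℤ) satisfy det g = 1, tr g > 2 and gᵀBg = B (so g is a hyperbolic direct isometry of (ℤ², B) with two positive real eigenvalues λ > 1 > λ⁻¹). Let C be a connected component of the open positive cone { x ∈ ℝ² : xᵀBx > 0 }; then g(C) = C. Moreover, there exists a finite set S of points of ℤ² ∩ C such that every lattice point θ ∈ ℤ² ∩ C can be written as θ = gⁿ(s₁ + s₂ + ⋯ + s_m) for some integer n ∈ ℤ, some m ≥ 1, and some s₁, …, s_m ∈ S (repetitions allowed). -/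
open Matrix

/-- A hyperbolic isometry of an integral binary form has real eigenforms `f₁`, `f₂` for the
eigenvalues `μ > 1` and `μ⁻¹`, and their product is a positive multiple of the quadratic form. -/
theorem exists_eigenforms_of_hyperbolic_isometry
    (B : Matrix (Fin 2) (Fin 2) ℤ) (hsymm : B.IsSymm) (hdet : B.det < 0)
    (g : Matrix (Fin 2) (Fin 2) ℤ) (hg : g.det = 1) (htr : 2 < g.trace)
    (hiso : gᵀ * B * g = B) :
    ∃ (μ k : ℝ) (f₁ f₂ : (Fin 2 → ℝ) →ₗ[ℝ] ℝ), 1 < μ ∧ 0 < k ∧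
      (∀ x, f₁ ((g.map (Int.cast : ℤ → ℝ)).mulVec x) = μ * f₁ x) ∧
      (∀ x, f₂ ((g.map (Int.cast : ℤ → ℝ)).mulVec x) = μ⁻¹ * f₂ x) ∧
      (∀ x, f₁ x = 0 → f₂ x = 0 → x = 0) ∧
      ∀ x, k * (x ⬝ᵥ (B.map (Int.cast : ℤ → ℝ)).mulVec x) = f₁ x * f₂ x := by
  obtain ⟨p, hp⟩ : ∃ p, p = g 0 0 := ⟨_, rfl⟩
  obtain ⟨q, hq⟩ : ∃ q, q = g 0 1 := ⟨_, rfl⟩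
  obtain ⟨r, hr⟩ : ∃ r, r = g 1 0 := ⟨_, rfl⟩
  obtain ⟨s, hs⟩ : ∃ s, s = g 1 1 := ⟨_, rfl⟩
  obtain ⟨a, ha⟩ : ∃ a, a = B 0 0 := ⟨_, rfl⟩
  obtain ⟨b, hb⟩ : ∃ b, b = B 0 1 := ⟨_, rfl⟩
  obtain ⟨c, hc⟩ : ∃ c, c = B 1 1 := ⟨_, rfl⟩
  have hb' : B 1 0 = b := by rw [hb]; exact hsymm.apply 0 1
  rw [Matrix.det_fin_two, hb', ← ha, ← hb, ← hc] at hdet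
  rw [Matrix.det_fin_two, ← hp, ← hq, ← hr, ← hs] at hg
  rw [Matrix.trace_fin_two, ← hp, ← hs] at htr
  have e00 := congrFun (congrFun hiso 0) 0
  have e01 := congrFun (congrFun hiso 0) 1
  have e11 := congrFun (congrFun hiso 1) 1
  simp only [Matrix.mul_apply, Fin.sum_univ_two, Matrix.transpose_apply, hb', ← ha, ← hb, ← hc,
    ← hp, ← hq, ← hr, ← hs] at e00 e01 e11
  have h1 : a * p + 2 * b * r = a * s := by
    linear_combination s * e00 - r * e01 - (a * p + b * r) * hg
  have h2 : a * q = - (c * r) := by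
    linear_combination s * e01 - r * e11 - (a * q + b * s) * hg
  have hr0 : r ≠ 0 := by
    rintro h
    rw [h] at hg
    have hps : p * s = 1 := by linarith
    rcases Int.eq_one_or_neg_one_of_mul_eq_one' hps with h | h <;> omega
  have ha0 : a ≠ 0 := by
    intro h
    rw [h] at h1 hdet
    have : b = 0 := by
      have : b * r = 0 := by linarith
      exact (mul_eq_zero.mp this).resolve_right hr0
    rw [this] at hdet
    simp at hdet
  have hgR : (p : ℝ) * s - q * r = 1 := by exact_mod_cast hg
  have htR : (2 : ℝ) < p + s := by exact_mod_cast htr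
  have h1R : (a : ℝ) * p + 2 * b * r = a * s := by exact_mod_cast h1
  have h2R : (a : ℝ) * q = - (c * r) := by exact_mod_cast h2
  have hrR : (r : ℝ) ≠ 0 := by exact_mod_cast hr0
  have haR : (a : ℝ) ≠ 0 := by exact_mod_cast ha0
  obtain ⟨μ, hμ, hμe⟩ : ∃ μ : ℝ, 1 < μ ∧ μ * μ - (p + s) * μ + 1 = 0 := by
    refine ⟨((p + s) + √((p + s) ^ 2 - 4)) / 2, ?_, ?_⟩
    · have := Real.sqrt_nonneg (((p : ℝ) + s) ^ 2 - 4)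
      linarith
    · have := Real.mul_self_sqrt (show (0 : ℝ) ≤ (p + s) ^ 2 - 4 by nlinarith)
      linear_combination this / 4
  have hμ0 : μ ≠ 0 := by positivity
  obtain ⟨ν, hν⟩ : ∃ ν, ν = μ⁻¹ := ⟨_, rfl⟩
  have hμν : μ * ν = 1 := by rw [hν]; exact mul_inv_cancel₀ hμ0
  have hsum : μ + ν = p + s := by
    apply mul_left_cancel₀ hμ0
    linear_combination hμe + hμν
  have hne : μ - ν ≠ 0 := by
    have : ν < 1 := hν ▸ inv_lt_one_of_one_lt₀ hμ
    linarith
  let π (i : Fin 2) : (Fin 2 → ℝ) →ₗ[ℝ] ℝ := LinearMap.proj i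
  refine ⟨μ, r ^ 2, (r : ℝ) • π 0 + (μ - p) • π 1,
    (a : ℝ) • ((r : ℝ) • π 0 + (ν - p) • π 1), hμ, by positivity, ?_, ?_, ?_, ?_⟩
  · intro x
    simp [π, ← hp, ← hq, ← hr, ← hs]
    linear_combination x 1 * (-hgR - μ * hsum + hμν)
  · intro x
    simp [π, ← hp, ← hq, ← hr, ← hs, ← hν]
    linear_combination a * x 1 * (-hgR - ν * hsum + hμν)
  · intro x hx1 hx2
    simp [π] at hx1 hx2
    have hx2' : r * x 0 + (ν - p) * x 1 = 0 :=
      (mul_eq_zero.mp ((mul_add _ _ _).trans hx2)).resolve_left haR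
    have h3 : x 1 = 0 := by
      have : (μ - ν) * x 1 = 0 := by linear_combination hx1 - hx2'
      exact (mul_eq_zero.mp this).resolve_left hne
    have h4 : x 0 = 0 := by simpa [h3, hrR] using hx1
    ext i
    fin_cases i <;> assumption
  · intro x
    simp [π, Matrix.mulVec, dotProduct, Fin.sum_univ_two, hb', ← ha, ← hb, ← hc]
    linear_combination r * x 0 * x 1 * (h1R - a * hsum) + x 1 ^ 2 * (r * h2R - a * hμν
      + a * p * hsum + a * hgR)

/-- A connected component of `{f₁ * f₂ > 0}` is an open quadrant. -/
theorem connectedComponentIn_mul_pos {E : Type*} [AddCommGroup E] [Module ℝ E]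
    [TopologicalSpace E] [IsTopologicalAddGroup E] [ContinuousSMul ℝ E]
    (f₁ f₂ : E →L[ℝ] ℝ) {x : E} (h₁ : 0 < f₁ x) (h₂ : 0 < f₂ x) :
    connectedComponentIn {y | 0 < f₁ y * f₂ y} x = {y | 0 < f₁ y ∧ 0 < f₂ y} := by
  have hx : x ∈ {y | 0 < f₁ y * f₂ y} := mul_pos h₁ h₂
  apply Set.Subset.antisymm
  · intro y hy
    have hyF := connectedComponentIn_subset _ _ hy
    rw [Set.mem_ofPred_eq] at hyF
    have hy1 : 0 < f₁ y := by
      by_contra! hle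
      obtain ⟨z, hz, hz0⟩ := isPreconnected_connectedComponentIn.intermediate_value hy
        (mem_connectedComponentIn hx) f₁.continuous.continuousOn ⟨hle, h₁.le⟩
      have hzF := connectedComponentIn_subset _ _ hz
      simp [hz0] at hzF
    exact ⟨hy1, (mul_pos_iff_of_pos_left hy1).mp hyF⟩
  · have hconv : Convex ℝ {y | 0 < f₁ y ∧ 0 < f₂ y} :=
      (convex_halfSpace_gt f₁.isLinear 0).inter (convex_halfSpace_gt f₂.isLinear 0)
    exact hconv.isPreconnected.subset_connectedComponentIn ⟨h₁, h₂⟩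
      fun y hy => mul_pos hy.1 hy.2

theorem Matrix.apply_zpow_mulVec_of_eigen {n R K : Type*} [Fintype n] [DecidableEq n] [CommRing R]
    [Field K] (g : Matrix n n R) (hg : IsUnit g.det) (F : (n → R) → K) {μ : K} (hμ : μ ≠ 0)
    (h : ∀ θ, F (g.mulVec θ) = μ * F θ) (k : ℤ) (θ : n → R) :
    F ((g ^ k).mulVec θ) = μ ^ k * F θ := by
  induction k generalizing θ with
  | zero => simp
  | succ i ih =>
    rw [Matrix.zpow_add_one hg, ← Matrix.mulVec_mulVec, ih, h, zpow_add_one₀ hμ, mul_assoc]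
  | pred i ih =>
    have h' : F (g⁻¹.mulVec θ) = μ⁻¹ * F θ := by
      rw [eq_inv_mul_iff_mul_eq₀ hμ, ← h, Matrix.mulVec_mulVec, Matrix.mul_nonsing_inv g hg,
        Matrix.one_mulVec]
    rw [Matrix.zpow_sub_one hg, ← Matrix.mulVec_mulVec, ih, h', zpow_sub_one₀ hμ, mul_assoc]

/-- A vector whose ratio of eigenform values lies between those of `v` and `g v` lies in the
closed cone spanned by `v` and `g v`; here in eigencoordinates. -/
theorem exists_nonneg_combination_of_ratio {μ p q P Q : ℝ} (hμ : 1 < μ) (hp : 0 < p) (hq : 0 < q)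
    (hl : Q * p ≤ P * q) (hu : P * q ≤ μ ^ 2 * (Q * p)) :
    ∃ α β : ℝ, 0 ≤ α ∧ 0 ≤ β ∧ P = α * p + β * (μ * p) ∧ Q = α * q + β * (μ⁻¹ * q) := by
  have h : 0 < μ ^ 2 - 1 := by nlinarith
  refine ⟨(μ ^ 2 * (Q * p) - P * q) / ((μ ^ 2 - 1) * (p * q)),
    μ * (P * q - Q * p) / ((μ ^ 2 - 1) * (p * q)), ?_, ?_, ?_, ?_⟩
  · exact div_nonneg (by linarith) (by positivity)
  · exact div_nonneg (mul_nonneg (by linarith) (by linarith)) (by positivity)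
  · field_simp
    ring
  · field_simp
    ring

/-- Lattice points of the quadrant spanned by two eigenforms of `g` are, up to powers of `g`,
sums of elements of a fixed finite set of lattice points of this quadrant. -/
theorem exists_finset_generating_quadrant {ι : Type*} [Fintype ι] [DecidableEq ι]
    (g : Matrix ι ι ℤ) (hg : IsUnit g.det) {μ : ℝ} (hμ : 1 < μ) (f₁ f₂ : (ι → ℝ) →ₗ[ℝ] ℝ)
    (hf₁ : ∀ x, f₁ ((g.map (Int.cast : ℤ → ℝ)).mulVec x) = μ * f₁ x)
    (hf₂ : ∀ x, f₂ ((g.map (Int.cast : ℤ → ℝ)).mulVec x) = μ⁻¹ * f₂ x)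
    (hinj : ∀ x, f₁ x = 0 → f₂ x = 0 → x = 0) :
    ∃ S : Finset (ι → ℤ),
      (∀ s ∈ S, 0 < f₁ (fun i => ((s i : ℤ) : ℝ)) ∧ 0 < f₂ (fun i => ((s i : ℤ) : ℝ))) ∧
      ∀ θ : ι → ℤ, 0 < f₁ (fun i => ((θ i : ℤ) : ℝ)) → 0 < f₂ (fun i => ((θ i : ℤ) : ℝ)) →
        ∃ (n : ℤ) (l : Multiset (ι → ℤ)), l ≠ 0 ∧ (∀ s ∈ l, s ∈ S) ∧
          θ = (g ^ n).mulVec l.sum := by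
  classical
  let c (θ : ι → ℤ) : ι → ℝ := fun i => ((θ i : ℤ) : ℝ)
  by_cases hv : ∃ v : ι → ℤ, 0 < f₁ (c v) ∧ 0 < f₂ (c v)
  swap
  · push Not at hv
    exact ⟨∅, by simp, fun θ h1 h2 => absurd h2 (hv θ h1).not_gt⟩
  obtain ⟨v, hv1, hv2⟩ := hv
  have hμ0 : 0 < μ := by linarith
  have hcg (θ : ι → ℤ) : c (g.mulVec θ) = (g.map (Int.cast : ℤ → ℝ)).mulVec (c θ) := by
    ext i
    simp [c, Matrix.mulVec, dotProduct]
  obtain ⟨w, hw⟩ : ∃ w, w = g.mulVec v := ⟨_, rfl⟩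
  have hw1 : f₁ (c w) = μ * f₁ (c v) := by rw [hw, hcg, hf₁]
  have hw2 : f₂ (c w) = μ⁻¹ * f₂ (c v) := by rw [hw, hcg, hf₂]
  have hw1p : 0 < f₁ (c w) := by rw [hw1]; positivity
  have hw2p : 0 < f₂ (c w) := by rw [hw2]; positivity
  let M : ι → ℤ := fun i => |v i| + |w i|
  let S : Finset (ι → ℤ) := (Finset.Icc (-M) M).filter fun s => 0 < f₁ (c s) ∧ 0 < f₂ (c s)
  have hvS : v ∈ S := by
    simp only [S, Finset.mem_filter, Finset.mem_Icc, Pi.le_def]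
    refine ⟨⟨fun i => ?_, fun i => ?_⟩, hv1, hv2⟩ <;> simp only [M, Pi.neg_apply] <;>
      linarith [neg_abs_le (v i), le_abs_self (v i), abs_nonneg (w i)]
  have hwS : w ∈ S := by
    simp only [S, Finset.mem_filter, Finset.mem_Icc, Pi.le_def]
    refine ⟨⟨fun i => ?_, fun i => ?_⟩, hw1p, hw2p⟩ <;> simp only [M, Pi.neg_apply] <;>
      linarith [neg_abs_le (w i), le_abs_self (w i), abs_nonneg (v i)]
  refine ⟨S, fun s hs => (Finset.mem_filter.mp hs).2, fun θ hθ1 hθ2 => ?_⟩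
  change 0 < f₁ (c θ) at hθ1
  change 0 < f₂ (c θ) at hθ2
  obtain ⟨n, hn1, hn2⟩ := exists_mem_Ico_zpow (x := f₁ (c θ) * f₂ (c v) / (f₂ (c θ) * f₁ (c v)))
    (y := μ ^ 2) (by positivity) (by nlinarith)
  obtain ⟨η, hη⟩ : ∃ η, η = (g ^ (-n)).mulVec θ := ⟨_, rfl⟩
  have hη1 : f₁ (c η) = μ ^ (-n) * f₁ (c θ) := by
    rw [hη]
    exact g.apply_zpow_mulVec_of_eigen hg (fun θ => f₁ (c θ)) hμ0.ne'
      (fun θ => by rw [hcg, hf₁]) _ _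
  have hη2 : f₂ (c η) = μ ^ n * f₂ (c θ) := by
    rw [hη]
    simpa using g.apply_zpow_mulVec_of_eigen hg (fun θ => f₂ (c θ)) (inv_ne_zero hμ0.ne')
      (fun θ => by rw [hcg, hf₂]) (-n) θ
  have hθη : θ = (g ^ n).mulVec η := by
    rw [hη, Matrix.mulVec_mulVec, ← Matrix.zpow_add hg, add_neg_cancel, zpow_zero,
      Matrix.one_mulVec]
  have hη1p : 0 < f₁ (c η) := by rw [hη1]; positivity
  obtain ⟨α, β, hα, hβ, e1, e2⟩ := exists_nonneg_combination_of_ratio (P := f₁ (c η))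
    (Q := f₂ (c η)) hμ hv1 hv2
    (by
      rw [le_div_iff₀ (by positivity)] at hn1
      rw [hη1, hη2, _root_.zpow_neg, mul_assoc, mul_assoc, le_inv_mul_iff₀ (by positivity)]
      refine le_of_eq_of_le ?_ hn1
      rw [← zpow_natCast, zpow_comm, zpow_natCast]
      ring)
    (by
      rw [div_lt_iff₀ (by positivity), zpow_add_one₀ (by positivity)] at hn2
      rw [hη1, hη2, _root_.zpow_neg, mul_assoc, inv_mul_le_iff₀ (by positivity)]
      refine hn2.le.trans_eq ?_
      rw [← zpow_natCast μ, zpow_comm, zpow_natCast, zpow_natCast]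
      ring)
  have hηc : c η = α • c v + β • c w := by
    rw [← sub_eq_zero]
    apply hinj
    · simp only [map_sub, map_add, map_smul, smul_eq_mul, hw1]
      linarith
    · simp only [map_sub, map_add, map_smul, smul_eq_mul, hw2]
      linarith
  obtain ⟨ρ, hρ⟩ : ∃ ρ, ρ = η - (⌊α⌋₊ • v + ⌊β⌋₊ • w) := ⟨_, rfl⟩
  have hηρ : η = ⌊α⌋₊ • v + ⌊β⌋₊ • w + ρ := by rw [hρ]; abel
  obtain ⟨a, ha⟩ : ∃ a, a = α - ⌊α⌋₊ := ⟨_, rfl⟩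
  obtain ⟨b, hb⟩ : ∃ b, b = β - ⌊β⌋₊ := ⟨_, rfl⟩
  have ha0 : 0 ≤ a := by linarith [Nat.floor_le hα]
  have hb0 : 0 ≤ b := by linarith [Nat.floor_le hβ]
  have ha1 : a ≤ 1 := by linarith [Nat.lt_floor_add_one α]
  have hb1 : b ≤ 1 := by linarith [Nat.lt_floor_add_one β]
  have hρc : c ρ = a • c v + b • c w := by
    ext i
    have := congrFun hηc i
    simp [c, hρ, ha, hb] at this ⊢
    linarith
  have hρM (i : ι) : |ρ i| ≤ M i := by
    have h := congrFun hρc i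
    simp only [c, Pi.add_apply, Pi.smul_apply, smul_eq_mul] at h
    have : |(ρ i : ℝ)| ≤ |(v i : ℝ)| + |(w i : ℝ)| := by
      rw [h]
      refine (abs_add_le _ _).trans ?_
      rw [abs_mul, abs_mul, abs_of_nonneg ha0, abs_of_nonneg hb0]
      exact add_le_add (mul_le_of_le_one_left (abs_nonneg _) ha1)
        (mul_le_of_le_one_left (abs_nonneg _) hb1)
    exact_mod_cast this
  have hρS : ρ = 0 ∨ ρ ∈ S := by
    by_cases h0 : a = 0 ∧ b = 0
    · left
      ext i
      have h := congrFun hρc i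
      simpa [c, h0.1, h0.2] using h
    · right
      have hab : 0 < a ∨ 0 < b := by
        by_contra! h
        exact h0 ⟨le_antisymm h.1 ha0, le_antisymm h.2 hb0⟩
      refine Finset.mem_filter.mpr ⟨Finset.mem_Icc.mpr ⟨fun i => (abs_le.mp (hρM i)).1,
        fun i => (abs_le.mp (hρM i)).2⟩, ?_⟩
      rw [hρc]
      simp only [map_add, map_smul, smul_eq_mul]
      rcases hab with h | h <;> constructor <;> positivity
  obtain ⟨l, hlS, hl⟩ : ∃ l : Multiset (ι → ℤ), (∀ s ∈ l, s ∈ S) ∧ η = l.sum := by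
    let l₀ := Multiset.replicate ⌊α⌋₊ v + Multiset.replicate ⌊β⌋₊ w
    have hl₀ : ∀ s ∈ l₀, s ∈ S := by
      intro s hs
      rcases Multiset.mem_add.mp hs with h | h <;> rw [Multiset.eq_of_mem_replicate h] <;>
        assumption
    rcases hρS with h | h
    · exact ⟨l₀, hl₀, by simp [l₀, hηρ, h]⟩
    · refine ⟨ρ ::ₘ l₀, ?_, by simp [l₀, hηρ, add_comm]⟩
      intro s hs
      rcases Multiset.mem_cons.mp hs with rfl | hs
      exacts [h, hl₀ s hs]
  refine ⟨n, l, ?_, hlS, hl ▸ hθη⟩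
  rintro rfl
  rw [Multiset.sum_zero] at hl
  have : c η = 0 := by rw [hl]; ext i; simp [c]
  simp [this] at hη1p



/-- Let `B ∈ M₂(ℤ)` be symmetric with `det B < 0` and let `g ∈ M₂(ℤ)` satisfy
`det g = 1`, `tr g > 2` and `gᵀBg = B`. Let `C` be a connected component of the open positive
cone `{x ∈ ℝ² : xᵀBx > 0}`. Then `g(C) = C`, and there is a finite set `S` of lattice points
of `ℤ² ∩ C` such that every lattice point `θ ∈ ℤ² ∩ C` can be written as `gⁿ(s₁ + ⋯ + s_m)`
for some `n ∈ ℤ`, `m ≥ 1` and `s₁, …, s_m ∈ S` (repetitions allowed). -/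
theorem fundamental_domain_for_hyperbolic_isometry
    (B : Matrix (Fin 2) (Fin 2) ℤ) (hsymm : B.IsSymm) (hdet : B.det < 0)
    (g : Matrix (Fin 2) (Fin 2) ℤ) (hg : g.det = 1) (htr : 2 < g.trace)
    (hiso : gᵀ * B * g = B)
    (C : Set (Fin 2 → ℝ))
    (hC : ∃ x ∈ {x : Fin 2 → ℝ | 0 < x ⬝ᵥ (B.map (Int.cast : ℤ → ℝ)).mulVec x},
      C = connectedComponentIn
        {x : Fin 2 → ℝ | 0 < x ⬝ᵥ (B.map (Int.cast : ℤ → ℝ)).mulVec x} x) :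
    (fun x : Fin 2 → ℝ => (g.map (Int.cast : ℤ → ℝ)).mulVec x) '' C = C ∧
    ∃ S : Finset (Fin 2 → ℤ),
      (∀ s ∈ S, (fun i => ((s i : ℤ) : ℝ)) ∈ C) ∧
      ∀ θ : Fin 2 → ℤ, (fun i => ((θ i : ℤ) : ℝ)) ∈ C →
        ∃ (n : ℤ) (l : Multiset (Fin 2 → ℤ)), l ≠ 0 ∧ (∀ s ∈ l, s ∈ S) ∧
          θ = (g ^ n).mulVec l.sum := by
  obtain ⟨x, hx, rfl⟩ := hC
  obtain ⟨μ, k, f₁, f₂, hμ, hk, hf₁, hf₂, hinj, hQ, h₁, h₂⟩ :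
      ∃ (μ k : ℝ) (f₁ f₂ : (Fin 2 → ℝ) →ₗ[ℝ] ℝ), 1 < μ ∧ 0 < k ∧
        (∀ x, f₁ ((g.map (Int.cast : ℤ → ℝ)).mulVec x) = μ * f₁ x) ∧
        (∀ x, f₂ ((g.map (Int.cast : ℤ → ℝ)).mulVec x) = μ⁻¹ * f₂ x) ∧
        (∀ x, f₁ x = 0 → f₂ x = 0 → x = 0) ∧
        (∀ x, k * (x ⬝ᵥ (B.map (Int.cast : ℤ → ℝ)).mulVec x) = f₁ x * f₂ x) ∧
        0 < f₁ x ∧ 0 < f₂ x := by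
    obtain ⟨μ, k, f₁, f₂, hμ, hk, hf₁, hf₂, hinj, hQ⟩ :=
      exists_eigenforms_of_hyperbolic_isometry B hsymm hdet g hg htr hiso
    have hpos : 0 < f₁ x * f₂ x := hQ x ▸ mul_pos hk hx
    rcases mul_pos_iff.mp hpos with h | h
    · exact ⟨μ, k, f₁, f₂, hμ, hk, hf₁, hf₂, hinj, hQ, h⟩
    · exact ⟨μ, k, -f₁, -f₂, hμ, hk, by simpa using hf₁, by simpa using hf₂,
        by simpa using hinj, by simpa using hQ, by simpa using h⟩
  have hC : connectedComponentIn
      {x : Fin 2 → ℝ | 0 < x ⬝ᵥ (B.map (Int.cast : ℤ → ℝ)).mulVec x} x =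
      {y | 0 < f₁ y ∧ 0 < f₂ y} := by
    have hset : {x : Fin 2 → ℝ | 0 < x ⬝ᵥ (B.map (Int.cast : ℤ → ℝ)).mulVec x} =
        {y | 0 < f₁ y * f₂ y} := by
      ext y
      simp only [Set.mem_ofPred_eq, ← hQ, mul_pos_iff_of_pos_left hk]
    rw [hset]
    exact connectedComponentIn_mul_pos f₁.toContinuousLinearMap f₂.toContinuousLinearMap h₁ h₂
  have hμ0 : 0 < μ := by linarith
  have hu : IsUnit g.det := by simp [hg]
  rw [hC]
  refine ⟨?_, exists_finset_generating_quadrant g hu hμ f₁ f₂ hf₁ hf₂ hinj |>.imp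
    fun S hS => ⟨hS.1, fun θ hθ => hS.2 θ hθ.1 hθ.2⟩⟩
  have hpre : {y | 0 < f₁ y ∧ 0 < f₂ y} =
      (fun x : Fin 2 → ℝ => (g.map (Int.cast : ℤ → ℝ)).mulVec x) ⁻¹'
        {y | 0 < f₁ y ∧ 0 < f₂ y} := by
    ext y
    simp only [Set.mem_preimage, Set.mem_ofPred_eq, hf₁, hf₂, mul_pos_iff_of_pos_left hμ0,
      mul_pos_iff_of_pos_left (inv_pos.mpr hμ0)]
  have hsurj : Function.Surjective
      (fun x : Fin 2 → ℝ => (g.map (Int.cast : ℤ → ℝ)).mulVec x) := by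
    refine Matrix.mulVec_surjective_iff_isUnit.mpr ?_
    exact ((Matrix.isUnit_iff_isUnit_det g).mpr hu).map (Int.castRingHom ℝ).mapMatrix
  conv_lhs => rw [hpre]
  exact Set.image_preimage_eq _ hsurj
end

section
/- Let d ≥ 2 and let P ∈ ℝ[X₀, …, X_d] be a homogeneous polynomial of degree δ ≥ 2 which is irreducible as an element of ℂ[X₀, …, X_d] (i.e. the hypersurface it defines is geometrically irreducible). Then there exist ℝ-linearly independent vectors a, b ∈ ℝ^{d+1} and a complex number z ∈ ℂ ∖ ℝ such that the one-variable polynomial q(t) = P(a + t·b) ∈ ℝ[t] is not identically zero and satisfies q(z) = 0. Equivalently, there is a real projective line in ℙ^d not contained in the hypersurface { P = 0 } whose intersection with the complex hypersurface, counted with multiplicity, contains at most δ − 2 real points. -/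
open Polynomial in
/-- The Laguerre inequality for split real polynomials. -/
theorem Polynomial.Splits.eval_mul_eval_derivative_two_le {p : ℝ[X]} (hp : p.Splits) (t : ℝ) :
    p.eval t * (derivative (derivative p)).eval t ≤ (derivative p).eval t ^ 2 := by
  obtain ⟨m, hm⟩ := Polynomial.splits_iff_exists_multiset.1 hp
  rw [hm]
  generalize p.leadingCoeff = c
  clear hm hp
  induction m using Multiset.induction_on with
  | empty => simp
  | cons a m ih =>
    rw [Multiset.map_cons, Multiset.prod_cons, mul_left_comm]
    generalize C c * (m.map (X - C ·)).prod = q at ih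
    simp only [derivative_mul, derivative_sub, derivative_X, derivative_C, sub_zero, one_mul,
      derivative_add, eval_add, eval_mul, eval_sub, eval_X, eval_C]
    nlinarith [mul_nonneg (sq_nonneg (t - a)) (sub_nonneg.2 ih), sq_nonneg (q.eval t)]

open Polynomial in
/-- A real polynomial without nonreal complex roots splits. -/
theorem Polynomial.splits_of_aeval_ne_zero_of_im_ne_zero {p : ℝ[X]}
    (hp : ∀ z : ℂ, z.im ≠ 0 → aeval z p ≠ 0) : p.Splits := by
  refine Splits.of_splits_map (algebraMap ℝ ℂ) (IsAlgClosed.splits _) fun z hz => ?_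
  have hz0 : aeval z p = 0 := by
    have := isRoot_of_mem_roots hz
    rwa [IsRoot, eval_map_algebraMap] at this
  have him : z.im = 0 := by_contra fun h => hp z h hz0
  exact ⟨z.re, Complex.ext (by simp) (by simp [him])⟩

open Polynomial in
theorem Polynomial.continuous_eval_iterate_derivative_eval_C (F : ℝ[X][X]) (n : ℕ) :
    Continuous fun x : ℝ × ℝ => (derivative^[n] (F.eval (C x.1))).eval x.2 := by
  induction F using Polynomial.induction_on' with
  | add p q hp hq =>
    simp only [eval_add, iterate_map_add]
    exact hp.add hq
  | monomial k a =>
    simp only [eval_monomial, ← C_pow, mul_comm a, iterate_derivative_C_mul, eval_C_mul]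
    fun_prop

open Polynomial in
/-- If the members of a family of real polynomials in `t`, depending polynomially on a parameter
`s`, satisfy the Laguerre inequality, then the zero set of the family has no isolated tangency
to the axis `s = 0`. -/
theorem Polynomial.coeff_zero_eq_zero_of_laguerre (F : ℝ[X][X])
    (hF : ∀ s t : ℝ, (F.eval (C s)).eval t * (derivative (derivative (F.eval (C s)))).eval t ≤
      (derivative (F.eval (C s))).eval t ^ 2)
    (h0 : (F.coeff 0).eval 0 = 0) (h1 : (derivative (F.coeff 0)).eval 0 = 0)
    (ha : (F.coeff 1).eval 0 ≠ 0) : F.coeff 0 = 0 := by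
  by_contra hA
  obtain ⟨R, hAR, hR⟩ := exists_eq_pow_rootMultiplicity_mul_and_not_dvd (F.coeff 0) hA 0
  have hk : 1 < (F.coeff 0).rootMultiplicity 0 :=
    (one_lt_rootMultiplicity_iff_isRoot hA).2 ⟨h0, h1⟩
  obtain ⟨m, hm⟩ := Nat.exists_eq_add_of_lt hk
  rw [hm, C_0, sub_zero] at hAR
  rw [dvd_iff_isRoot, IsRoot] at hR
  set c := R.eval 0 with hc
  set a := (F.coeff 1).eval 0 with ha'
  set M : ℝ := (m + 2) * c / a with hM
  set H := F.divX with hH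
  have hH0 : (H.eval (C 0)).eval 0 = a := by
    rw [C_0, ← coeff_zero_eq_eval_zero F.divX, coeff_divX]
  have hFs (s : ℝ) : F.eval (C s) = C s * H.eval (C s) + X ^ (m + 2) * R := by
    conv_lhs => rw [← divX_mul_X_add F]
    rw [hAR, eval_add, eval_mul, eval_X, eval_C, mul_comm]
    congr 2
    ring
  let h (n : ℕ) (t : ℝ) : ℝ := (derivative^[n] (H.eval (C (M * t ^ (m + 2))))).eval t
  have hcont (n : ℕ) : Continuous (h n) :=
    (continuous_eval_iterate_derivative_eval_C H n).comp
      (f := fun t : ℝ => (M * t ^ (m + 2), t)) (by fun_prop)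
  let E (t : ℝ) : ℝ :=
    (M * t * h 1 t + (m + 2) * R.eval t + t * (derivative R).eval t) ^ 2 -
    (M * h 0 t + R.eval t) * (M * t ^ 2 * h 2 t + (m + 2) * (m + 1) * R.eval t +
      2 * (m + 2) * t * (derivative R).eval t + t ^ 2 * (derivative (derivative R)).eval t)
  have hE : Continuous E := by
    have := hcont 0
    have := hcont 1
    have := hcont 2
    fun_prop
  have hEpos : ∀ t : ℝ, 0 < t → 0 ≤ E t := by
    intro t ht
    have key := hF (M * t ^ (m + 2)) t
    rw [hFs] at key
    simp only [derivative_add, derivative_mul, derivative_C, zero_mul, zero_add, eval_add,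
      eval_mul, eval_C, eval_pow, eval_X, derivative_X_pow, map_natCast, eval_natCast,
      derivative_natCast, Nat.add_sub_cancel, Nat.add_succ_sub_one] at key
    have : 0 ≤ (t ^ (m + 1)) ^ 2 * E t := by
      simp only [E, h, Function.iterate_zero, id, Function.iterate_succ, Function.comp]
      rw [← sub_nonneg] at key
      convert key using 1
      push_cast
      ring
    exact nonneg_of_mul_nonneg_right this (by positivity)
  have hE0 : 0 ≤ E 0 := by
    refine ge_of_tendsto (hE.tendsto 0 |>.mono_left (nhdsWithin_le_nhds (s := Set.Ioi 0))) ?_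
    filter_upwards [self_mem_nhdsWithin] with t ht using hEpos t ht
  have hE0' : E 0 = c ^ 2 * ((m + 2) ^ 2 - (m + 3) * (m + 2) * (m + 1)) := by
    have : h 0 0 = a := by simp [h, ← hH0]
    have hMa : M * a = (m + 2) * c := by rw [hM]; field_simp
    simp only [E, this, hMa]
    simp only [← hc]
    ring
  rw [hE0'] at hE0
  have : (0 : ℝ) ≤ m := m.cast_nonneg
  have hc2 : 0 < c ^ 2 := by positivity
  have := nonneg_of_mul_nonneg_right hE0 hc2
  nlinarith [mul_nonneg ‹(0:ℝ) ≤ m› ‹(0:ℝ) ≤ m›, pow_nonneg ‹(0:ℝ) ≤ m› 3]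

open Polynomial in
theorem MvPolynomial.derivative_aeval {σ R S : Type*} [Fintype σ] [CommSemiring R]
    [CommSemiring S] [Algebra R S] (q : σ → S[X]) (P : MvPolynomial σ R) :
    derivative (aeval q P) = ∑ i, aeval q (pderiv i P) * derivative (q i) := by
  classical
  induction P using MvPolynomial.induction_on with
  | C r => simp [Polynomial.algebraMap_apply]
  | add p p' hp hp' => simp [hp, hp', add_mul, Finset.sum_add_distrib]
  | mul_X p j hp =>
    simp only [map_mul, aeval_X, derivative_mul, hp, Derivation.leibniz, pderiv_X, smul_eq_mul,
      map_add, add_mul, Finset.sum_add_distrib, Pi.single_apply, Finset.sum_mul]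
    simp [apply_ite, ite_mul, add_comm, mul_assoc, mul_comm]

/-- The restriction of `P` to the line `t ↦ a + t • b`. -/
noncomputable def MvPolynomial.restrictLine {σ R : Type*} [CommSemiring R] (P : MvPolynomial σ R)
    (a b : σ → R) : Polynomial R :=
  aeval (fun i => Polynomial.C (a i) + Polynomial.C (b i) * Polynomial.X) P

theorem MvPolynomial.aeval_restrictLine {σ R A : Type*} [CommSemiring R] [CommSemiring A]
    [Algebra R A] (P : MvPolynomial σ R) (a b : σ → R) (z : A) :
    Polynomial.aeval z (P.restrictLine a b) =
      aeval (fun i => algebraMap R A (a i) + algebraMap R A (b i) * z) P := by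
  rw [restrictLine, ← AlgHom.comp_apply, comp_aeval]
  simp

theorem MvPolynomial.eval_restrictLine {σ R : Type*} [CommSemiring R]
    (P : MvPolynomial σ R) (a b : σ → R) (t : R) :
    (P.restrictLine a b).eval t = eval (fun i => a i + b i * t) P := by
  simpa [Polynomial.coe_aeval_eq_eval, coe_aeval_eq_eval] using P.aeval_restrictLine a b t

theorem MvPolynomial.IsHomogeneous.aeval_mul {σ R A : Type*} [CommSemiring R] [CommSemiring A]
    [Algebra R A] {P : MvPolynomial σ R} {n : ℕ} (hP : P.IsHomogeneous n) (r : A) (x : σ → A) :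
    MvPolynomial.aeval (fun i => r * x i) P = r ^ n * MvPolynomial.aeval x P := by
  simp only [MvPolynomial.aeval_def, eval₂_eq, Finset.mul_sum]
  refine Finset.sum_congr rfl fun m hm => ?_
  rw [Finset.prod_congr rfl fun i _ => mul_pow r (x i) (m i), Finset.prod_mul_distrib,
    Finset.prod_pow_eq_pow_sum, mul_left_comm, ← hP (mem_support_iff.1 hm),
    Finsupp.weight_apply]
  simp [Finsupp.sum]

/-- A real polynomial vanishing on the real lines spanned by the complex zeros of a prime `f` is
divisible by `f`. -/
theorem MvPolynomial.dvd_of_eval_add_mul_eq_zero {σ : Type*} [Finite σ]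
    {f g : MvPolynomial σ ℝ} (hf : Prime f)
    (h : ∀ u v : σ → ℝ, aeval (fun i => (u i : ℂ) + v i * Complex.I) f = 0 →
      ∀ t : ℝ, eval (fun i => u i + v i * t) g = 0) : f ∣ g := by
  have := (Ideal.span_singleton_prime hf.ne_zero).2 hf
  rw [← Ideal.mem_span_singleton, ← IsPrime.vanishingIdeal_zeroLocus (K := ℂ) (Ideal.span {f}),
    mem_vanishingIdeal_iff]
  intro x hx
  have hfx : aeval x f = 0 := hx f (Ideal.mem_span_singleton_self f)
  have hx' : x = fun i => ((x i).re : ℂ) + (x i).im * Complex.I := by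
    ext i; simp
  have hline : g.restrictLine (fun i => (x i).re) (fun i => (x i).im) = 0 := by
    refine Polynomial.funext fun t => ?_
    rw [eval_restrictLine, h _ _ (hx' ▸ hfx) t, Polynomial.eval_zero]
  have := g.aeval_restrictLine (fun i => (x i).re) (fun i => (x i).im) Complex.I
  rw [hline, map_zero] at this
  rw [hx']
  exact this.symm

theorem MvPolynomial.irreducible_of_map {σ K L : Type*} [Field K] [Field L] (f : K →+* L)
    {P : MvPolynomial σ K} (hP : Irreducible (map f P)) : Irreducible P := by
  have : IsLocalHom (map (σ := σ) f) := ⟨fun Q hQ => by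
    have := isUnit_iff_totalDegree_of_isReduced.1 hQ
    refine isUnit_iff_totalDegree_of_isReduced.2 ?_
    simpa [totalDegree, support_map_of_injective _ f.injective, coeff_map] using this⟩
  exact hP.of_map

theorem MvPolynomial.IsHomogeneous.eq_zero_of_pderiv_eq_zero {σ K : Type*} [Fintype σ] [Field K]
    [CharZero K] {P : MvPolynomial σ K} {n : ℕ} (hP : P.IsHomogeneous n) (hn : n ≠ 0)
    (h : ∀ i, pderiv i P = 0) : P = 0 := by
  have := hP.sum_X_mul_pderiv
  simp only [h, mul_zero, Finset.sum_const_zero] at this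
  exact (smul_eq_zero.1 this.symm).resolve_left hn

theorem MvPolynomial.IsHomogeneous.pderiv_eq_zero_of_dvd {σ K : Type*} [Field K]
    {P : MvPolynomial σ K} {n : ℕ} (hP : P.IsHomogeneous n) (hn : n ≠ 0) {i : σ}
    (h : P ∣ MvPolynomial.pderiv i P) : MvPolynomial.pderiv i P = 0 := by
  by_contra h0
  obtain ⟨Q, hQ⟩ := h
  have hP0 : P ≠ 0 := by rintro rfl; simp at h0
  have hQ0 : Q ≠ 0 := by rintro rfl; simp [hQ] at h0
  have h1 := hP.pderiv (i := i) |>.totalDegree h0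
  rw [hQ, totalDegree_mul_of_isDomain hP0 hQ0, hP.totalDegree hP0] at h1
  omega

/-- If the restrictions of `P` to all real lines satisfy the Laguerre inequality, then `P` vanishes on
every line tangent to its zero set at a simple real zero `x`. -/
theorem MvPolynomial.restrictLine_eq_zero_of_laguerre {σ : Type*} [Fintype σ]
    {P : MvPolynomial σ ℝ}
    (hP : ∀ (u v : σ → ℝ) (t : ℝ), (P.restrictLine u v).eval t *
      (Polynomial.derivative (Polynomial.derivative (P.restrictLine u v))).eval t ≤
      (Polynomial.derivative (P.restrictLine u v)).eval t ^ 2)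
    {x v e : σ → ℝ} (hx : eval x P = 0) (he : ∑ j, eval x (pderiv j P) * e j ≠ 0)
    (hv : ∑ j, eval x (pderiv j P) * v j = 0) : P.restrictLine x v = 0 := by
  let F : Polynomial (Polynomial ℝ) := aeval (fun j =>
    Polynomial.C (Polynomial.C (x j) + Polynomial.C (v j) * Polynomial.X) +
      Polynomial.C (Polynomial.C (e j)) * Polynomial.X) P
  have hF (s : ℝ) : F.eval (Polynomial.C s) =
      P.restrictLine (fun j => x j + e j * s) v := by
    rw [restrictLine, ← Polynomial.coe_aeval_eq_eval]
    change (((Polynomial.aeval (R := Polynomial ℝ) (Polynomial.C s)).restrictScalars ℝ).comp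
      (aeval _)) P = _
    rw [comp_aeval]
    congr 2
    ext1 j
    simp
    ring
  have hF0 : F.coeff 0 = P.restrictLine x v := by
    rw [Polynomial.coeff_zero_eq_eval_zero, ← Polynomial.C_0, hF]
    simp
  have hx0 (Q : MvPolynomial σ ℝ) : (Q.restrictLine x v).eval 0 = eval x Q := by
    simp [eval_restrictLine]
  rw [← hF0]
  refine Polynomial.coeff_zero_eq_zero_of_laguerre F (fun s t => hF s ▸ hP _ _ t) ?_ ?_ ?_
  · rw [hF0, hx0, hx]
  · rw [hF0, restrictLine, derivative_aeval, Polynomial.eval_finsetSum]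
    refine Eq.trans ?_ hv
    refine Finset.sum_congr rfl fun j _ => ?_
    rw [Polynomial.eval_mul]
    change (restrictLine _ x v).eval 0 * _ = _
    simp [hx0]
  · have : F.coeff 1 = (Polynomial.derivative F).coeff 0 := by
      simp [Polynomial.coeff_derivative]
    have h2 (Q : MvPolynomial σ ℝ) : (aeval (fun j =>
        Polynomial.C (Polynomial.C (x j) + Polynomial.C (v j) * Polynomial.X) +
        Polynomial.C (Polynomial.C (e j)) * Polynomial.X) Q).coeff 0 =
        Q.restrictLine x v := by
      rw [restrictLine, Polynomial.coeff_zero_eq_aeval_zero]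
      change (((Polynomial.aeval (R := Polynomial ℝ) 0).restrictScalars ℝ).comp
        (aeval _)) Q = _
      rw [comp_aeval]
      congr 2
      ext1 j
      simp
    rw [this, derivative_aeval]
    simpa [Polynomial.finsetSum_coeff, Polynomial.mul_coeff_zero, h2, hx0,
      Polynomial.eval_finsetSum, -map_add, -map_mul] using he

theorem MvPolynomial.irreducible_sum_C_mul_X {σ K : Type*} [Fintype σ] [Field K] {g : σ → K}
    (hg : g ≠ 0) : Irreducible (∑ i, C (g i) * X i) ∧
      (∑ i, C (g i) * X i : MvPolynomial σ K).totalDegree = 1 := by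
  classical
  have h0 : (∑ i, C (g i) * X i : MvPolynomial σ K) ≠ 0 := fun h => hg <| by
    ext j
    simpa [Pi.single_apply] using congr(eval (Pi.single j 1) $h)
  have hdeg : (∑ i, C (g i) * X i : MvPolynomial σ K).totalDegree = 1 :=
    (IsHomogeneous.sum _ _ _ fun i _ => isHomogeneous_C_mul_X (g i) i).totalDegree h0
  refine ⟨irreducible_of_totalDegree_eq_one hdeg fun r hr => ?_, hdeg⟩
  refine IsUnit.mk0 r fun hr0 => h0 ?_
  ext m
  simpa [hr0] using hr m

/-- A homogeneous real polynomial with a nonreal zero on the line `t ↦ u + t • v`, where `u` and `v`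
are linearly dependent, vanishes on that line. -/
theorem MvPolynomial.IsHomogeneous.restrictLine_eq_zero_of_not_linearIndependent {σ : Type*}
    {P : MvPolynomial σ ℝ} {n : ℕ} (hP : P.IsHomogeneous n) {u v : σ → ℝ}
    (huv : ¬ LinearIndependent ℝ ![u, v]) {z : ℂ} (hz : z.im ≠ 0)
    (h : Polynomial.aeval z (P.restrictLine u v) = 0) : P.restrictLine u v = 0 := by
  rw [aeval_restrictLine] at h
  refine Polynomial.funext fun t => ?_
  rw [eval_restrictLine, Polynomial.eval_zero]
  rw [LinearIndependent.pair_iff] at huv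
  push Not at huv
  obtain ⟨r, s, hrs, hne⟩ := huv
  have hreal (y : σ → ℝ) (hy : MvPolynomial.aeval (fun i => (y i : ℂ)) P = 0) : eval y P = 0 := by
    have := (aeval_algebraMap_apply ℂ y P).symm.trans hy
    simpa [aeval_eq_eval] using this
  by_cases hr : r = 0
  · have hv : v = 0 := by simpa [hr, hne hr] using hrs
    subst hv
    exact hreal _ (by simpa using h)
  · have hu (i : σ) : u i = -s / r * v i := by
      have := congrFun hrs i
      simp only [Pi.add_apply, Pi.smul_apply, smul_eq_mul, Pi.zero_apply] at this
      field_simp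
      linarith
    set c := -s / r
    have hcz : (c : ℂ) + z ≠ 0 := fun h0 => hz (by simpa using congr(($h0).im))
    have h1 := hP.aeval_mul ((c : ℂ) + z) fun i => (v i : ℂ)
    have e1 : (fun i => algebraMap ℝ ℂ (u i) + algebraMap ℝ ℂ (v i) * z) =
        fun i => ((c : ℂ) + z) * v i := by
      ext i; simp [hu i]; ring
    rw [← e1, h] at h1
    have h2 := hreal v ((mul_eq_zero.1 h1.symm).resolve_left (pow_ne_zero _ hcz))
    have h3 := hP.aeval_mul (c + t) v
    simp only [aeval_eq_eval, h2, mul_zero] at h3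
    rw [← h3]
    congr 2
    ext i
    rw [hu i]; ring


/-- Let `d ≥ 2` and let `P ∈ ℝ[X₀, …, X_d]` be homogeneous of degree `δ ≥ 2`
and irreducible over `ℂ`. Then there exist linearly independent vectors `a, b ∈ ℝ^{d+1}` and a
non-real complex number `z` such that the one-variable real polynomial
`q(t) = P(a + t·b)` is not identically zero and satisfies `q(z) = 0`. -/
theorem exists_real_line_with_nonreal_intersection
    (d : ℕ) (hd : 2 ≤ d) (δ : ℕ) (hδ : 2 ≤ δ)
    (P : MvPolynomial (Fin (d + 1)) ℝ) (hhom : P.IsHomogeneous δ)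
    (hirr : Irreducible (MvPolynomial.map (algebraMap ℝ ℂ) P)) :
    ∃ a b : Fin (d + 1) → ℝ, LinearIndependent ℝ ![a, b] ∧
      ∃ z : ℂ, z.im ≠ 0 ∧
        MvPolynomial.aeval
          (fun i => Polynomial.C (a i) + Polynomial.C (b i) * Polynomial.X) P ≠ 0 ∧
        Polynomial.aeval z
          (MvPolynomial.aeval
            (fun i => Polynomial.C (a i) + Polynomial.C (b i) * Polynomial.X) P) = 0 := by
  by_contra hcon
  push Not at hcon
  have hreal (u v : Fin (d + 1) → ℝ) (z : ℂ) (hz : z.im ≠ 0)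
      (h : Polynomial.aeval z (P.restrictLine u v) = 0) : P.restrictLine u v = 0 := by
    by_cases huv : LinearIndependent ℝ ![u, v]
    · exact by_contra fun h0 => hcon u v huv z hz h0 h
    · exact hhom.restrictLine_eq_zero_of_not_linearIndependent huv hz h
  have hlag (u v : Fin (d + 1) → ℝ) (t : ℝ) : (P.restrictLine u v).eval t *
      (Polynomial.derivative (Polynomial.derivative (P.restrictLine u v))).eval t ≤
      (Polynomial.derivative (P.restrictLine u v)).eval t ^ 2 := by
    by_cases h0 : P.restrictLine u v = 0
    · simp [h0]
    · exact (Polynomial.splits_of_aeval_ne_zero_of_im_ne_zero fun z hz h =>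
        h0 (hreal u v z hz h)).eval_mul_eval_derivative_two_le t
  have hP : Irreducible P := MvPolynomial.irreducible_of_map _ hirr
  obtain ⟨x, hx, i, hi⟩ : ∃ x, MvPolynomial.eval x P = 0 ∧
      ∃ i, MvPolynomial.eval x (MvPolynomial.pderiv i P) ≠ 0 := by
    by_contra! hsing
    refine hP.ne_zero (hhom.eq_zero_of_pderiv_eq_zero (by omega) fun i =>
      hhom.pderiv_eq_zero_of_dvd (by omega) ?_)
    refine MvPolynomial.dvd_of_eval_add_mul_eq_zero hP.prime fun u v huv t => hsing _ ?_ i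
    rw [← MvPolynomial.eval_restrictLine, hreal u v Complex.I (by simp), Polynomial.eval_zero]
    rw [MvPolynomial.aeval_restrictLine]
    exact huv
  set g := fun j => MvPolynomial.eval x (MvPolynomial.pderiv j P) with hg
  have hgx : ∑ j, g j * x j = 0 := by
    simpa [hx, mul_comm, hg] using congr(MvPolynomial.eval x $(hhom.sum_X_mul_pderiv))
  have htangent (w : Fin (d + 1) → ℝ) (hw : ∑ j, g j * w j = 0) : MvPolynomial.eval w P = 0 := by
    have := P.eval_restrictLine x (w - x) 1
    rw [MvPolynomial.restrictLine_eq_zero_of_laguerre hlag hx (e := Pi.single i 1)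
      (by simpa [Pi.single_apply] using hi)
      (by simp only [Pi.sub_apply, mul_sub, Finset.sum_sub_distrib]; rw [hw, hgx, sub_zero])] at this
    simpa using this.symm
  obtain ⟨hL, hLdeg⟩ := MvPolynomial.irreducible_sum_C_mul_X (g := g) fun h => hi (congrFun h i)
  have hdvd : (∑ j, MvPolynomial.C (g j) * MvPolynomial.X j) ∣ P := by
    refine MvPolynomial.dvd_of_eval_add_mul_eq_zero hL.prime fun u v huv t => htangent _ ?_
    have hre : ∑ j, g j * u j = 0 := by simpa using congr(($huv).re)
    have him : ∑ j, g j * v j = 0 := by simpa using congr(($huv).im)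
    simp only [mul_add, Finset.sum_add_distrib, hre, zero_add, ← mul_assoc, ← Finset.sum_mul,
      him, zero_mul]
  obtain ⟨Q, hQ⟩ := hdvd
  have hQunit := (hP.isUnit_or_isUnit hQ).resolve_left hL.not_isUnit
  have hdeg := hhom.totalDegree hP.ne_zero
  rw [hQ, MvPolynomial.totalDegree_mul_of_isDomain hL.ne_zero hQunit.ne_zero, hLdeg,
    (MvPolynomial.isUnit_iff_totalDegree_of_isReduced.1 hQunit).2] at hdeg
  omega
end
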